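/- arXiv:2601.21642 — 5 statements merged into one kernel-verified Lean document; each statement's English description precedes it below -/
import Mathlib

section
/- Let F be a finite field with #F = Q, let ψ : F → ℂ^× be a nontrivial additive character, and let a ≥ 1 be an integer dividing Q − 1. Let ρ_1, …, ρ_a be an enumeration of the a multiplicative characters of F^× whose order divides a. Then there exists a complex number c with |c| = 1, depending only on ψ and a, such that for every u ∈ F^×: −Σ_{x ∈ F^×, x^a = u} ψ(a·x) = c · Q^{-(a−1)/2} · Σ_{(x_1,…,x_a) ∈ (F^×)^a, x_1⋯x_a = u} ψ(x_1 + ⋯ + x_a) · ∏_{i=1}^{a} ρ_i(x_i). -/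
open scoped Real

open Polynomial in
/-- The monic polynomial of degree `n` with lower coefficients `c`. -/
noncomputable def monicOfCoeffs {F : Type*} [Field F] {n : ℕ} (c : Fin n → F) : F[X] :=
  X ^ n + ∑ i : Fin n, C (c i) * X ^ (i : ℕ)

section Monic

open Polynomial

variable {F : Type*} [Field F] {n : ℕ}

theorem degree_sum_coeffs_lt (c : Fin n → F) :
    (∑ i : Fin n, C (c i) * X ^ (i : ℕ)).degree < (n : WithBot ℕ) := by
  refine (degree_sum_le _ _).trans_lt ((Finset.sup_lt_iff (WithBot.bot_lt_coe n)).2 fun i _ => ?_)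
  exact (degree_C_mul_X_pow_le _ _).trans_lt (Nat.cast_lt.2 i.2)

theorem monic_monicOfCoeffs (c : Fin n → F) : (monicOfCoeffs c).Monic :=
  monic_X_pow_add (degree_sum_coeffs_lt c)

theorem natDegree_monicOfCoeffs (c : Fin n → F) : (monicOfCoeffs c).natDegree = n := by
  rw [monicOfCoeffs, natDegree_eq_of_degree_eq (degree_add_eq_left_of_degree_lt _),
    natDegree_X_pow]
  simpa using degree_sum_coeffs_lt c

theorem coeff_monicOfCoeffs (c : Fin n → F) (i : Fin n) : (monicOfCoeffs c).coeff i = c i := by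
  simp [monicOfCoeffs, coeff_X_pow, i.2.ne, Fin.val_inj]

theorem monicOfCoeffs_coeff {f : F[X]} (hf : f.Monic) :
    monicOfCoeffs (fun i : Fin f.natDegree => f.coeff i) = f := by
  conv_rhs => rw [hf.as_sum]
  rw [monicOfCoeffs, Fin.sum_univ_eq_sum_range (fun i => C (f.coeff i) * X ^ i)]

theorem monicOfCoeffs_injective : Function.Injective (monicOfCoeffs (F := F) (n := n)) := by
  intro c d h
  ext i
  rw [← coeff_monicOfCoeffs c, h, coeff_monicOfCoeffs]

variable (F n) in
/-- The finite set of monic polynomials of degree `n` over a finite field. -/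
noncomputable def monics [Fintype F] : Finset F[X] :=
  Finset.univ.map ⟨monicOfCoeffs (F := F) (n := n), monicOfCoeffs_injective⟩

theorem mem_monics [Fintype F] {f : F[X]} : f ∈ monics F n ↔ f.Monic ∧ f.natDegree = n := by
  simp only [monics, Finset.mem_map, Finset.mem_univ, true_and, Function.Embedding.coeFn_mk]
  constructor
  · rintro ⟨c, rfl⟩
    exact ⟨monic_monicOfCoeffs c, natDegree_monicOfCoeffs c⟩
  · rintro ⟨hf, rfl⟩
    exact ⟨_, monicOfCoeffs_coeff hf⟩

theorem sum_monics [Fintype F] {M : Type*} [AddCommMonoid M] (h : F[X] → M) :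
    ∑ f ∈ monics F n, h f = ∑ c : Fin n → F, h (monicOfCoeffs c) := by
  simp [monics]

end Monic

section PowerSum

open Polynomial
open scoped PowerSeries

variable {F : Type*} [Field F]

/-- The generating series of the power sums of the roots of `f`, as minus the logarithmic
derivative (with respect to `T d/dT`) of the reversed polynomial. -/
noncomputable def powerSumSeries (f : F[X]) : F⟦X⟧ :=
  -(PowerSeries.X * d⁄dX F (f.reverse : F⟦X⟧)) * (f.reverse : F⟦X⟧)⁻¹

theorem constantCoeff_reverse {f : F[X]} (hf : f.Monic) :
    PowerSeries.constantCoeff (f.reverse : F⟦X⟧) = 1 := by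
  simp [hf.leadingCoeff]

theorem powerSumSeries_mul_reverse {f : F[X]} (hf : f.Monic) :
    powerSumSeries f * (f.reverse : F⟦X⟧) = -(PowerSeries.X * d⁄dX F (f.reverse : F⟦X⟧)) := by
  rw [powerSumSeries, mul_assoc, PowerSeries.inv_mul_cancel, mul_one]
  simp [constantCoeff_reverse hf]

theorem eq_powerSumSeries {f : F[X]} (hf : f.Monic) {s : F⟦X⟧}
    (h : s * (f.reverse : F⟦X⟧) = -(PowerSeries.X * d⁄dX F (f.reverse : F⟦X⟧))) :
    s = powerSumSeries f := by
  rw [← powerSumSeries_mul_reverse hf] at h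
  refine mul_right_cancel₀ ?_ h
  intro h0
  simpa [h0] using constantCoeff_reverse hf

theorem powerSumSeries_mul {f g : F[X]} (hf : f.Monic) (hg : g.Monic) :
    powerSumSeries (f * g) = powerSumSeries f + powerSumSeries g := by
  refine (eq_powerSumSeries (hf.mul hg) ?_).symm
  rw [reverse_mul_of_domain, Polynomial.coe_mul, Derivation.leibniz, smul_eq_mul, smul_eq_mul]
  linear_combination (g.reverse : F⟦X⟧) * powerSumSeries_mul_reverse hf +
    (f.reverse : F⟦X⟧) * powerSumSeries_mul_reverse hg

theorem powerSumSeries_one : powerSumSeries (1 : F[X]) = 0 := by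
  refine (eq_powerSumSeries monic_one ?_).symm
  rw [← Polynomial.C_1, reverse_C]
  simp

theorem powerSumSeries_prod {ι : Type*} (s : Finset ι) (f : ι → F[X])
    (hf : ∀ i ∈ s, (f i).Monic) :
    powerSumSeries (∏ i ∈ s, f i) = ∑ i ∈ s, powerSumSeries (f i) := by
  classical
  induction s using Finset.induction_on with
  | empty => simp [powerSumSeries_one]
  | insert i s hi ih =>
    rw [Finset.prod_insert hi, Finset.sum_insert hi, powerSumSeries_mul (hf i (by simp))
      (monic_prod_of_monic _ _ fun j hj => hf j (by simp [hj])), ih fun j hj => hf j (by simp [hj])]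

theorem reverse_X_sub_C (x : F) : (X - C x : F[X]).reverse = 1 - C x * X := by
  ext i
  rw [reverse, natDegree_X_sub_C, coeff_reflect]
  rcases i with _ | _ | i
  · simp [revAt_le]
  · simp [revAt_le, Polynomial.coeff_one]
  · rw [revAt_eq_self_of_lt (by omega)]
    simp [coeff_X, coeff_one]

theorem powerSumSeries_X_sub_C (x : F) :
    powerSumSeries (X - C x) = PowerSeries.mk fun m => if m = 0 then 0 else x ^ m := by
  refine (eq_powerSumSeries (monic_X_sub_C x) ?_).symm
  rw [reverse_X_sub_C]
  have h : ((1 - C x * X : F[X]) : F⟦X⟧) = 1 - PowerSeries.C x * PowerSeries.X := by simp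
  rw [h]
  ext m
  rcases m with _ | _ | m <;>
    simp [mul_sub, ← mul_assoc, mul_comm _ (PowerSeries.C x), PowerSeries.coeff_succ_mul_X,
      PowerSeries.coeff_mk, PowerSeries.coeff_C, pow_succ']

theorem map_powerSumSeries {E : Type*} [Field E] (φ : F →+* E) {f : F[X]} (hf : f.Monic) :
    (powerSumSeries f).map φ = powerSumSeries (f.map φ) := by
  have h : ((f.map φ).reverse : E⟦X⟧) = (f.reverse : F⟦X⟧).map φ := by
    ext i
    simp [reverse, coeff_reflect, natDegree_map]
  refine eq_powerSumSeries (hf.map φ) ?_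
  rw [h, ← map_mul, powerSumSeries_mul_reverse hf]
  ext m
  rcases m with _ | m <;> simp [PowerSeries.coeff_succ_X_mul, PowerSeries.coeff_derivative]

theorem coeff_powerSumSeries_sub {f g : F[X]} (hf : f.Monic) (hg : g.Monic) {n m : ℕ}
    (hfn : f.natDegree = n) (hgn : g.natDegree = n) (hmn : m ≤ n) (hm : m ≠ 0)
    (h : ∀ i, n - m < i → f.coeff i = g.coeff i) :
    PowerSeries.coeff m (powerSumSeries f) - PowerSeries.coeff m (powerSumSeries g) =
      -(m * (f.coeff (n - m) - g.coeff (n - m))) := by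
  have hdvd : (PowerSeries.X : F⟦X⟧) ^ m ∣ (f.reverse : F⟦X⟧) - (g.reverse : F⟦X⟧) := by
    rw [PowerSeries.X_pow_dvd_iff]
    intro i hi
    rw [map_sub, Polynomial.coeff_coe, Polynomial.coeff_coe, reverse, reverse, coeff_reflect,
      coeff_reflect, hfn, hgn, revAt_le (by omega), h _ (by omega), sub_self]
  obtain ⟨d, hd⟩ := hdvd
  have hd0 : PowerSeries.constantCoeff d = f.coeff (n - m) - g.coeff (n - m) := by
    have := congrArg (PowerSeries.coeff m) hd
    rw [map_sub, Polynomial.coeff_coe, Polynomial.coeff_coe, reverse, reverse, coeff_reflect,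
      coeff_reflect, hfn, hgn, revAt_le (by omega)] at this
    rw [this]
    simpa using (PowerSeries.coeff_X_pow_mul d m 0).symm
  have hf1 := powerSumSeries_mul_reverse hf
  have hg1 := powerSumSeries_mul_reverse hg
  have hfr : (f.reverse : F⟦X⟧) = (g.reverse : F⟦X⟧) + PowerSeries.X ^ m * d := by
    rw [← hd]; ring
  have hinv : (f.reverse : F⟦X⟧) * (f.reverse : F⟦X⟧)⁻¹ = 1 :=
    PowerSeries.mul_inv_cancel _ (by simp [constantCoeff_reverse hf])
  have key : powerSumSeries f - powerSumSeries g = PowerSeries.X ^ m *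
      ((-((m : F⟦X⟧) * d) - PowerSeries.X * d⁄dX F d - powerSumSeries g * d) *
        (f.reverse : F⟦X⟧)⁻¹) := by
    have hder : d⁄dX F (f.reverse : F⟦X⟧) = d⁄dX F (g.reverse : F⟦X⟧) +
        (PowerSeries.X ^ m * d⁄dX F d + d * ((m : F⟦X⟧) * PowerSeries.X ^ (m - 1))) := by
      rw [hfr, map_add, Derivation.leibniz, Derivation.leibniz_pow]
      simp
    obtain ⟨m, rfl⟩ := Nat.exists_eq_succ_of_ne_zero hm
    simp only [Nat.succ_eq_add_one, Nat.add_sub_cancel] at hder hfr ⊢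
    rw [hder] at hf1
    linear_combination (-(powerSumSeries f - powerSumSeries g)) * hinv +
      (f.reverse : F⟦X⟧)⁻¹ * (hf1 - hg1 - powerSumSeries g * hfr)
  rw [← map_sub, key]
  have := PowerSeries.coeff_X_pow_mul
    ((-((m : F⟦X⟧) * d) - PowerSeries.X * d⁄dX F d - powerSumSeries g * d) *
        (f.reverse : F⟦X⟧)⁻¹) m 0
  rw [zero_add] at this
  rw [this]
  have h0 : PowerSeries.constantCoeff (powerSumSeries g) = 0 := by simp [powerSumSeries]
  simp [h0, hd0, hf.leadingCoeff]

end PowerSum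

section ConjProduct

open Polynomial

variable (F : Type*) {E : Type*} [Field F] [Field E] [Algebra F E] [FiniteDimensional F E]

/-- The power of the minimal polynomial of `x` whose degree is `[E : F]`, i.e. the
characteristic polynomial of `x`. -/
noncomputable def fieldPoly (x : E) : F[X] :=
  minpoly F x ^ (Module.finrank F E / (minpoly F x).natDegree)

theorem natDegree_minpoly_dvd (x : E) : (minpoly F x).natDegree ∣ Module.finrank F E :=
  minpoly.degree_dvd (Algebra.IsIntegral.isIntegral x)

theorem monic_fieldPoly (x : E) : (fieldPoly F x).Monic :=
  (minpoly.monic (Algebra.IsIntegral.isIntegral x)).pow _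

theorem natDegree_fieldPoly (x : E) : (fieldPoly F x).natDegree = Module.finrank F E := by
  rw [fieldPoly, natDegree_pow, Nat.div_mul_cancel (natDegree_minpoly_dvd F x)]

theorem eq_minpoly_pow {x : E} {n : ℕ} {f : F[X]} (hf : f.Monic) (hn : f.natDegree = n)
    (h : ∀ g : F[X], g.Monic → Irreducible g → g ∣ f → g = minpoly F x) :
    f = minpoly F x ^ (n / (minpoly F x).natDegree) := by
  classical
  have hx := Algebra.IsIntegral.isIntegral (R := F) x
  have hrep := Multiset.eq_replicate_card.2 fun g hg =>
    have hg' := (Polynomial.mem_normalizedFactors_iff hf.ne_zero).1 hg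
    h g hg'.2.1 hg'.1 hg'.2.2
  have hprod := UniqueFactorizationMonoid.prod_normalizedFactors_eq hf.ne_zero
  rw [hrep, Multiset.prod_replicate, hf.normalize_eq_self] at hprod
  have hdeg := congrArg natDegree hprod
  rw [natDegree_pow, hn] at hdeg
  rw [← hdeg, Nat.mul_div_cancel _ (minpoly.natDegree_pos hx), hprod]

theorem exists_map_eq_prod_automorphisms [IsGalois F E] (x : E) :
    ∃ f : F[X], f.map (algebraMap F E) = ∏ σ : Gal(E/F), (X - C (σ x)) := by
  rw [← mem_lifts, lifts_iff_coeff_lifts]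
  intro i
  refine (IsGalois.mem_range_algebraMap_iff_fixed _).2 fun τ => ?_
  have h : (∏ σ : Gal(E/F), (X - C (σ x))).map (τ : E →+* E) =
      ∏ σ : Gal(E/F), (X - C (σ x)) := by
    rw [Polynomial.map_prod]
    refine Fintype.prod_bijective (fun σ => τ * σ) (Group.mulLeft_bijective τ) _ _ fun σ => ?_
    simp
  conv_rhs => rw [← h]
  rw [coeff_map]
  rfl

theorem map_fieldPoly [IsGalois F E] (x : E) :
    (fieldPoly F x).map (algebraMap F E) = ∏ σ : Gal(E/F), (X - C (σ x)) := by
  classical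
  obtain ⟨f, hf⟩ := exists_map_eq_prod_automorphisms F x
  have hfm : f.Monic := by
    have : (f.map (algebraMap F E)).Monic := by
      rw [hf]; exact monic_prod_of_monic _ _ fun σ _ => monic_X_sub_C _
    exact Polynomial.monic_of_injective (algebraMap F E).injective this
  have hfn : f.natDegree = Module.finrank F E := by
    rw [← natDegree_map (algebraMap F E), hf, natDegree_prod_of_monic _ _ fun σ _ =>
      monic_X_sub_C _]
    simp [← IsGalois.card_aut_eq_finrank F E, Nat.card_eq_fintype_card]
  rw [fieldPoly, ← eq_minpoly_pow F (x := x) hfm hfn ?_, hf]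
  intro g hg hgi hgf
  have h1 : g.map (algebraMap F E) ∣ ∏ σ : Gal(E/F), (X - C (σ x)) := by
    rw [← hf]; exact Polynomial.map_dvd _ hgf
  have hs : (g.map (algebraMap F E)).Splits :=
    (Splits.prod fun σ _ => Splits.X_sub_C _).of_dvd
      (Finset.prod_ne_zero_iff.2 fun σ _ => X_sub_C_ne_zero _) h1
  obtain ⟨y, hy⟩ := hs.exists_eval_eq_zero (by
    rw [degree_map]; exact (degree_pos_of_irreducible hgi).ne')
  have h2 := eval_dvd (x := y) h1
  rw [hy, zero_dvd_iff, eval_prod, Finset.prod_eq_zero_iff] at h2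
  obtain ⟨σ, -, hσ⟩ := h2
  rw [eval_sub, eval_X, eval_C, sub_eq_zero] at hσ
  rw [eval_map_algebraMap] at hy
  rw [minpoly.eq_of_irreducible_of_monic hgi hy hg, hσ, minpoly.algEquiv_eq]

theorem coeff_zero_fieldPoly [IsGalois F E] (x : E) :
    (-1) ^ (fieldPoly F x).natDegree * (fieldPoly F x).coeff 0 = Algebra.norm F x := by
  apply (algebraMap F E).injective
  rw [Algebra.norm_eq_prod_automorphisms, map_mul, ← coeff_map, map_fieldPoly,
    coeff_zero_eq_eval_zero, eval_prod, natDegree_fieldPoly, ← IsGalois.card_aut_eq_finrank F E]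
  simp [Finset.prod_neg, ← mul_assoc, ← mul_pow, Nat.card_eq_fintype_card]

theorem coeff_powerSumSeries_fieldPoly [IsGalois F E] (x : E) {m : ℕ} (hm : m ≠ 0) :
    PowerSeries.coeff m (powerSumSeries (fieldPoly F x)) = Algebra.trace F E (x ^ m) := by
  apply (algebraMap F E).injective
  rw [trace_eq_sum_automorphisms, ← PowerSeries.coeff_map, map_powerSumSeries _
    (monic_fieldPoly F x), map_fieldPoly, powerSumSeries_prod _ _ fun σ _ => monic_X_sub_C _]
  simp [powerSumSeries_X_sub_C, hm]

end ConjProduct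

section Recurrence

open Polynomial UniqueFactorizationMonoid
open scoped Classical

variable {F : Type*} [Field F]

theorem pow_dvd_iff_le_count {P f : F[X]} (hP : P.Monic) (hPi : Irreducible P)
    (hf : f ≠ 0) (j : ℕ) : P ^ j ∣ f ↔ j ≤ (normalizedFactors f).count P := by
  rw [dvd_iff_normalizedFactors_le_normalizedFactors (pow_ne_zero _ hPi.ne_zero) hf,
    normalizedFactors_pow, normalizedFactors_irreducible hPi, hP.normalize_eq_self,
    Multiset.nsmul_singleton, Multiset.le_count_iff_replicate_le]

variable [Fintype F]

theorem card_minpoly_eq {E : Type*} [Field E] [Fintype E] [Algebra F E]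
    {P : F[X]} (hP : P.Monic) (hPi : Irreducible P) :
    (Finset.univ.filter fun x : E => minpoly F x = P).card =
      if P.natDegree ∣ Module.finrank F E then P.natDegree else 0 := by
  have hiff : ∀ x : E, minpoly F x = P ↔ x ∈ P.rootSet E := by
    intro x
    rw [mem_rootSet_of_ne hP.ne_zero]
    exact ⟨fun h => h ▸ minpoly.aeval F x,
      fun h => (minpoly.eq_of_irreducible_of_monic hPi h hP).symm⟩
  split_ifs with hd
  · have hE : Nat.card E = Nat.card F ^ Module.finrank F E := Module.natCard_eq_pow_finrank
    have hn : Module.finrank F E ≠ 0 := Module.finrank_pos.ne'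
    have hdvd := Polynomial.map_dvd (algebraMap F E)
      (hPi.natDegree_dvd_iff_dvd_X_pow_card_pow_sub_X.1 hd)
    rw [← hE, Polynomial.map_sub, Polynomial.map_pow, map_X] at hdvd
    have hsplit : (P.map (algebraMap F E)).Splits :=
      (Polynomial.splits_X_pow_nat_card_sub_X).of_dvd
        (FiniteField.X_pow_card_sub_X_ne_zero E Finite.one_lt_card) hdvd
    rw [← card_rootSet_eq_natDegree (K := E) (PerfectField.separable_of_irreducible hPi) hsplit,
      ← Set.toFinset_card]
    congr 1
    ext x
    simp [hiff]
  · rw [Finset.card_eq_zero, Finset.filter_eq_empty_iff]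
    rintro x - rfl
    exact hd (natDegree_minpoly_dvd F x)

theorem card_fieldPoly_dvd {E : Type*} [Field E] [Fintype E] [Algebra F E]
    {f : F[X]} (hf : f.Monic) :
    (Finset.univ.filter fun x : E => fieldPoly F x ∣ f).card =
      ∑ P ∈ (normalizedFactors f).toFinset,
        if P.natDegree ∣ Module.finrank F E ∧
          Module.finrank F E / P.natDegree ≤ (normalizedFactors f).count P
        then P.natDegree else 0 := by
  rw [Finset.card_eq_sum_card_fiberwise (f := fun x : E => minpoly F x)
    (t := (normalizedFactors f).toFinset)]
  · refine Finset.sum_congr rfl fun P hP => ?_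
    rw [Multiset.mem_toFinset, Polynomial.mem_normalizedFactors_iff hf.ne_zero] at hP
    obtain ⟨hPi, hPm, hPf⟩ := hP
    rw [Finset.filter_filter]
    have h : ∀ x : E, (fieldPoly F x ∣ f ∧ minpoly F x = P) ↔ (minpoly F x = P ∧
        Module.finrank F E / P.natDegree ≤ (normalizedFactors f).count P) := by
      intro x
      rw [and_comm]
      refine and_congr_right fun hx => ?_
      rw [fieldPoly, hx, pow_dvd_iff_le_count hPm hPi hf.ne_zero]
    simp_rw [h]
    by_cases hc : Module.finrank F E / P.natDegree ≤ (normalizedFactors f).count P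
    · simp [hc, card_minpoly_eq hPm hPi]
    · simp [hc]
  · intro x hx
    have hx' : fieldPoly F x ∣ f := by simpa using hx
    have hi := Algebra.IsIntegral.isIntegral (R := F) x
    have hpos := Nat.div_pos (Nat.le_of_dvd Module.finrank_pos (natDegree_minpoly_dvd F x))
      (minpoly.natDegree_pos hi)
    rw [Finset.mem_coe, Multiset.mem_toFinset, Polynomial.mem_normalizedFactors_iff hf.ne_zero]
    exact ⟨minpoly.irreducible hi, minpoly.monic hi, (dvd_pow_self _ hpos.ne').trans hx'⟩

theorem card_filter_dvd_div_le {d v n : ℕ} (hd : 0 < d) (h : d * v ≤ n) :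
    ((Finset.range n).filter fun k => d ∣ k + 1 ∧ (k + 1) / d ≤ v).card = v := by
  rw [← Finset.card_range v]
  symm
  refine Finset.card_bij (fun j _ => d * (j + 1) - 1) ?_ ?_ ?_
  · intro j hj
    rw [Finset.mem_range] at hj
    have h1 : 0 < d * (j + 1) := by positivity
    have h2 : d * (j + 1) ≤ d * v := Nat.mul_le_mul_left d hj
    rw [Finset.mem_filter, Finset.mem_range, Nat.sub_add_cancel h1, Nat.mul_div_cancel_left _ hd,
      Finset.card_range]
    exact ⟨by omega, dvd_mul_right _ _, hj⟩
  · intro i _ j _ hij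
    have h1 : 0 < d * (i + 1) := by positivity
    have h2 : 0 < d * (j + 1) := by positivity
    have h3 : d * (i + 1) = d * (j + 1) := by omega
    have := Nat.eq_of_mul_eq_mul_left hd h3
    omega
  · intro k hk
    rw [Finset.mem_filter, Finset.mem_range, Finset.card_range] at hk
    obtain ⟨-, ⟨j, hj⟩, hv⟩ := hk
    rw [hj, Nat.mul_div_cancel_left _ hd] at hv
    have hj0 : j ≠ 0 := by rintro rfl; simp at hj
    refine ⟨j - 1, by rw [Finset.mem_range]; omega, ?_⟩
    rw [Nat.sub_add_cancel (Nat.pos_of_ne_zero hj0), ← hj, Nat.add_sub_cancel]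

variable (p : ℕ) [Fact p.Prime] [CharP F p]

noncomputable instance (n : ℕ) [NeZero n] : Fintype (FiniteField.Extension F p n) :=
  Fintype.ofFinite _

theorem sum_card_fieldPoly_dvd {f : F[X]} (hf : f.Monic) {n : ℕ}
    (hn : f.natDegree = n) :
    ∑ k ∈ Finset.range n, (Finset.univ.filter
      fun x : FiniteField.Extension F p (k + 1) => fieldPoly F x ∣ f).card = n := by
  simp_rw [card_fieldPoly_dvd hf, FiniteField.finrank_extension]
  rw [Finset.sum_comm]
  have hdeg : ∑ P ∈ (normalizedFactors f).toFinset,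
      (normalizedFactors f).count P • P.natDegree = n := by
    rw [← Finset.sum_multiset_map_count,
      ← natDegree_multiset_prod _ (zero_notMem_normalizedFactors _),
      prod_normalizedFactors_eq hf.ne_zero, hf.normalize_eq_self, hn]
  conv_rhs => rw [← hdeg]
  refine Finset.sum_congr rfl fun P hP => ?_
  have hP' := hP
  rw [Multiset.mem_toFinset, Polynomial.mem_normalizedFactors_iff hf.ne_zero] at hP'
  rw [← Finset.sum_filter, Finset.sum_const, card_filter_dvd_div_le hP'.1.natDegree_pos]
  rw [← hdeg, mul_comm]
  exact Finset.single_le_sum (f := fun P => (normalizedFactors f).count P • P.natDegree)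
    (fun _ _ => Nat.zero_le _) hP

/-- The generating series of the sums of `θ` over monic polynomials. -/
noncomputable def monicSeries (θ : F[X] → ℂ) : PowerSeries ℂ :=
  PowerSeries.mk fun n => ∑ f ∈ monics F n, θ f

/-- The generating series of the sums of `θ` over characteristic polynomials of elements of the
finite extensions of `F`, indexed by the degree minus one. -/
noncomputable def extensionSeries (θ : F[X] → ℂ) : PowerSeries ℂ :=
  PowerSeries.mk fun k => ∑ x : FiniteField.Extension F p (k + 1), θ (fieldPoly F x)

theorem sum_monics_mul (θ : F[X] → ℂ) {P : F[X]} (hP : P.Monic) {l n : ℕ}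
    (hn : P.natDegree + l = n) :
    ∑ g ∈ monics F l, θ (P * g) = ∑ f ∈ monics F n, if P ∣ f then θ f else 0 := by
  rw [← Finset.sum_filter]
  refine Finset.sum_bij (fun g _ => P * g) ?_ ?_ ?_ fun _ _ => rfl
  · intro g hg
    rw [mem_monics] at hg
    rw [Finset.mem_filter, mem_monics]
    exact ⟨⟨hP.mul hg.1, by rw [hP.natDegree_mul hg.1, hg.2, hn]⟩, dvd_mul_right _ _⟩
  · intro g _ g' _ h
    exact mul_left_cancel₀ hP.ne_zero h
  · intro f hf
    rw [Finset.mem_filter, mem_monics] at hf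
    obtain ⟨⟨hf, hfn⟩, g, rfl⟩ := hf
    have hg := hP.of_mul_monic_left hf
    rw [hP.natDegree_mul hg] at hfn
    exact ⟨g, mem_monics.2 ⟨hg, by omega⟩, rfl⟩

theorem derivative_monicSeries {θ : F[X] → ℂ}
    (hθ : ∀ f g : F[X], f.Monic → g.Monic → θ (f * g) = θ f * θ g) :
    PowerSeries.derivative ℂ (monicSeries θ) = extensionSeries p θ * monicSeries θ := by
  ext n
  rw [PowerSeries.coeff_derivative, PowerSeries.coeff_mul,
    Finset.Nat.sum_antidiagonal_eq_sum_range_succ_mk]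
  simp only [monicSeries, extensionSeries, PowerSeries.coeff_mk]
  have h1 : ∀ k ∈ Finset.range n.succ,
      (∑ x : FiniteField.Extension F p (k + 1), θ (fieldPoly F x)) *
        ∑ f ∈ monics F (n - k), θ f =
      ∑ f ∈ monics F (n + 1), θ f * ((Finset.univ.filter
        fun x : FiniteField.Extension F p (k + 1) => fieldPoly F x ∣ f).card : ℂ) := by
    intro k hk
    rw [Finset.mem_range] at hk
    rw [Finset.sum_mul]
    have h2 : ∀ x : FiniteField.Extension F p (k + 1),
        θ (fieldPoly F x) * ∑ f ∈ monics F (n - k), θ f =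
          ∑ f ∈ monics F (n + 1), if fieldPoly F x ∣ f then θ f else 0 := by
      intro x
      rw [← sum_monics_mul θ (monic_fieldPoly F x) (l := n - k), Finset.mul_sum]
      · exact Finset.sum_congr rfl fun g hg =>
          (hθ _ _ (monic_fieldPoly F x) (mem_monics.1 hg).1).symm
      · rw [natDegree_fieldPoly, FiniteField.finrank_extension]
        omega
    rw [Finset.sum_congr rfl fun x _ => h2 x, Finset.sum_comm]
    refine Finset.sum_congr rfl fun f _ => ?_
    rw [← Finset.sum_filter, Finset.sum_const, nsmul_eq_mul, mul_comm]
  rw [Finset.sum_congr rfl h1, Finset.sum_comm, Finset.sum_mul]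
  refine Finset.sum_congr rfl fun f hf => ?_
  rw [mem_monics] at hf
  rw [← Finset.mul_sum, ← Nat.cast_sum, sum_card_fieldPoly_dvd p hf.1 hf.2]
  push_cast
  rfl

theorem constantCoeff_monicSeries {θ : F[X] → ℂ} (hθ : θ 1 = 1) :
    PowerSeries.constantCoeff (monicSeries θ) = 1 := by
  rw [← PowerSeries.coeff_zero_eq_constantCoeff_apply, monicSeries, PowerSeries.coeff_mk,
    sum_monics]
  simp [monicOfCoeffs, hθ]

theorem eq_of_derivative_eq_mul {L M S : PowerSeries ℂ} (hL0 : PowerSeries.constantCoeff L = 1)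
    (hM0 : PowerSeries.constantCoeff M = 1) (hL : PowerSeries.derivative ℂ L = S * L)
    (hM : PowerSeries.derivative ℂ M = S * M) : L = M := by
  have hinv : M * M⁻¹ = 1 := PowerSeries.mul_inv_cancel _ (by simp [hM0])
  have h : L * M⁻¹ = 1 := by
    refine PowerSeries.derivative.ext ?_ (by simp [hL0, hM0])
    rw [Derivation.leibniz, PowerSeries.derivative_inv', hL, hM, PowerSeries.derivative_one,
      smul_eq_mul, smul_eq_mul]
    linear_combination (-(S * L * M⁻¹)) * hinv
  linear_combination M * h - L * hinv

theorem derivative_prod_eq_mul {ι : Type*} (s : Finset ι) {L S : ι → PowerSeries ℂ}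
    (h : ∀ i ∈ s, PowerSeries.derivative ℂ (L i) = S i * L i) :
    PowerSeries.derivative ℂ (∏ i ∈ s, L i) = (∑ i ∈ s, S i) * ∏ i ∈ s, L i := by
  induction s using Finset.induction_on with
  | empty => simp
  | insert i s hi ih =>
    rw [Finset.prod_insert hi, Finset.sum_insert hi, Derivation.leibniz, h i (by simp),
      ih fun j hj => h j (by simp [hj]), smul_eq_mul, smul_eq_mul]
    ring

end Recurrence

section Characters

theorem sum_units_eq_sum {K M : Type*} [Field K] [Fintype K] [Fintype Kˣ] [AddCommMonoid M]
    {f : K → M} (h0 : f 0 = 0) : ∑ x : Kˣ, f x = ∑ x : K, f x := by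
  classical
  refine Finset.sum_of_injOn (fun x : Kˣ => (x : K)) (Units.val_injective.injOn) (by simp) ?_
    (fun _ _ => rfl)
  intro x _ hx
  have : x = 0 := by
    by_contra hne
    exact hx ⟨Units.mk0 x hne, by simp⟩
  rw [this, h0]

theorem sum_characters_eq_card_roots {G : Type*} [CommGroup G] [Fintype G] [DecidableEq G]
    [IsCyclic G] {a : ℕ} (ha : a ≠ 0) (hadvd : a ∣ Nat.card G) {τ : Fin a → (G →* ℂˣ)}
    (hτ : Function.Injective τ) (hτa : ∀ i, τ i ^ a = 1) (y : G) :
    ∑ i, (τ i y : ℂ) = ((Finset.univ.filter fun x : G => x ^ a = y).card : ℂ) := by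
  have : NeZero a := ⟨ha⟩
  by_cases hy : ∃ z : G, z ^ a = y
  · obtain ⟨z, rfl⟩ := hy
    have h1 : ∀ i, (τ i (z ^ a) : ℂ) = 1 := by
      intro i
      rw [map_pow, ← MonoidHom.pow_apply, hτa i]
      simp
    have h2 : (Finset.univ.filter fun x : G => x ^ a = z ^ a).card = a := by
      have hker := IsCyclic.card_powMonoidHom_ker G a
      rw [Nat.gcd_eq_right hadvd] at hker
      refine Eq.trans ?_ hker
      rw [Nat.card_eq_fintype_card, ← Fintype.card_coe]
      refine Fintype.card_congr ⟨fun x => ⟨x.1 / z, ?_⟩, fun x => ⟨x.1 * z, ?_⟩, ?_, ?_⟩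
      · have hx := x.2
        rw [Finset.mem_filter] at hx
        simp [MonoidHom.mem_ker, div_pow, hx.2]
      · have hx := x.2
        rw [MonoidHom.mem_ker, powMonoidHom_apply] at hx
        simp [mul_pow, hx]
      · intro x; simp
      · intro x; simp
    rw [h2]
    simp only [h1]
    simp
  · have h0 : (Finset.univ.filter fun x : G => x ^ a = y) = ∅ := by
      rw [Finset.filter_eq_empty_iff]
      exact fun x _ hx => hy ⟨x, hx⟩
    rw [h0, Finset.card_empty, Nat.cast_zero]
    obtain ⟨g, hg⟩ := IsCyclic.exists_monoid_generator (α := G)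
    obtain ⟨m, hm⟩ := hg y
    have hm' : g ^ m = y := hm
    have : Fintype (rootsOfUnity a ℂ) := Fintype.ofFinite _
    let φ : Fin a → rootsOfUnity a ℂ := fun i =>
      ⟨τ i g, by rw [mem_rootsOfUnity, ← MonoidHom.pow_apply, hτa i]; simp⟩
    have hφ : Function.Injective φ := by
      intro i j hij
      refine hτ (MonoidHom.ext fun x => ?_)
      obtain ⟨k, hk⟩ := hg x
      have hk' : g ^ k = x := hk
      rw [← hk', map_pow, map_pow]
      exact congrArg (fun t => t ^ k) (congrArg Subtype.val hij)
    have hbij : Function.Bijective φ := by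
      rw [Fintype.bijective_iff_injective_and_card]
      refine ⟨hφ, ?_⟩
      rw [Fintype.card_fin, ← Nat.card_eq_fintype_card, Complex.card_rootsOfUnity]
    have hsum : ∑ i, (τ i y : ℂ) =
        ∑ ζ : rootsOfUnity a ℂ, (((ζ ^ m : rootsOfUnity a ℂ) : ℂˣ) : ℂ) := by
      refine Fintype.sum_bijective φ hbij _ _ fun i => ?_
      rw [← hm', map_pow]
      rfl
    rw [hsum]
    have hζ := Complex.isPrimitiveRoot_exp a ha
    set ζ₀ : rootsOfUnity a ℂ := hζ.toRootsOfUnity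
    have hne : (((ζ₀ ^ m : rootsOfUnity a ℂ) : ℂˣ) : ℂ) ≠ 1 := by
      have : (((ζ₀ ^ m : rootsOfUnity a ℂ) : ℂˣ) : ℂ) =
          Complex.exp (2 * Real.pi * Complex.I / a) ^ m := by
        simp [ζ₀, IsPrimitiveRoot.toRootsOfUnity]
      rw [this]
      intro h1
      obtain ⟨k, rfl⟩ := hζ.dvd_of_pow_eq_one m h1
      exact hy ⟨g ^ k, by rw [← hm', mul_comm, pow_mul]⟩
    refine eq_zero_of_mul_eq_self_left hne ?_
    rw [Finset.mul_sum]
    refine Fintype.sum_bijective (fun ζ => ζ₀ * ζ) (Group.mulLeft_bijective ζ₀) _ _ fun ζ => ?_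
    simp [mul_pow]

variable {F : Type*} [Field F] [Fintype F]

theorem sum_mulChar_norm_eq_card_roots {E : Type*} [Field E] [Fintype E] [DecidableEq E]
    [Algebra F E] {a : ℕ} (ha : a ≠ 0) (hadvd : a ∣ Fintype.card F - 1)
    {ρ : Fin a → MulChar F ℂ} (hρ : Function.Injective ρ) (hρa : ∀ i, ρ i ^ a = 1) (y : Eˣ) :
    ∑ i, ρ i (Algebra.norm F (y : E)) =
      ((Finset.univ.filter fun x : Eˣ => x ^ a = y).card : ℂ) := by
  classical
  have hcard : a ∣ Nat.card Eˣ := by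
    rw [Nat.card_units, Module.natCard_eq_pow_finrank (K := F), Nat.card_eq_fintype_card]
    refine hadvd.trans ?_
    simpa using Nat.sub_dvd_pow_sub_pow (Fintype.card F) 1 (Module.finrank F E)
  rw [← sum_characters_eq_card_roots ha hcard
    (τ := fun i => (ρ i).toUnitHom.comp (Units.map (Algebra.norm F (S := E))))]
  · refine Finset.sum_congr rfl fun i _ => ?_
    simp
  · intro i j hij
    refine hρ (MulChar.ext fun u => ?_)
    obtain ⟨x, rfl⟩ := FiniteField.unitsMap_norm_surjective F E u
    have := congrArg Units.val (DFunLike.congr_fun hij x)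
    simpa [MulChar.coe_toUnitHom] using this
  · intro i
    ext x
    have := DFunLike.congr_fun (hρa i) (Algebra.norm F (x : E))
    rw [MulChar.pow_apply' _ ha] at this
    have hx : IsUnit (Algebra.norm F (x : E)) := x.isUnit.map (Algebra.norm F)
    rw [MulChar.one_apply hx] at this
    simpa using this

theorem eq_zero_of_forall_sum_mulChar_mul [DecidableEq F] {h : Fˣ → ℂ}
    (hh : ∀ χ : MulChar F ℂ, ∑ u : Fˣ, χ u * h u = 0) (v : Fˣ) : h v = 0 := by
  have : Fintype (MulChar F ℂ) := Fintype.ofFinite _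
  have horth : ∀ u : Fˣ, u ≠ 1 → ∑ χ : MulChar F ℂ, χ u = 0 := by
    intro u hu
    obtain ⟨χ, hχ⟩ := MulChar.exists_apply_ne_one_of_hasEnoughRootsOfUnity F ℂ
      (a := (u : F)) (by simpa using hu)
    refine eq_zero_of_mul_eq_self_left hχ ?_
    simp only [Finset.mul_sum, ← MulChar.mul_apply]
    exact Fintype.sum_bijective _ (Group.mulLeft_bijective χ) _ _ fun χ' => rfl
  have hsum : ∑ χ : MulChar F ℂ, χ ((v⁻¹ : Fˣ) : F) * ∑ u : Fˣ, χ u * h u = 0 := by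
    simp [hh]
  simp_rw [Finset.mul_sum] at hsum
  rw [Finset.sum_comm, Finset.sum_eq_single v] at hsum
  · have h1 : ∀ χ : MulChar F ℂ, χ ((v⁻¹ : Fˣ) : F) * (χ v * h v) = h v := by
      intro χ
      rw [← mul_assoc, ← map_mul, Units.inv_mul, map_one, one_mul]
    simp only [h1, Finset.sum_const, nsmul_eq_mul, mul_eq_zero, Nat.cast_eq_zero,
      Finset.card_eq_zero] at hsum
    exact hsum.resolve_left Finset.univ_nonempty.ne_empty
  · intro u _ hu
    simp_rw [← mul_assoc, ← map_mul, ← Finset.sum_mul, ← Units.val_mul]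
    rw [horth, zero_mul]
    rwa [Ne, inv_mul_eq_one, eq_comm]
  · simp

theorem norm_gaussSum {χ : MulChar F ℂ} (hχ : χ ≠ 1) {ψ : AddChar F ℂ} (hψ : ψ.IsPrimitive) :
    ‖gaussSum χ ψ‖ = √(Fintype.card F) := by
  have h := gaussSum_mul_gaussSum_eq_card hχ hψ
  rw [← star_gaussSum_eq, ← starRingEnd_apply, Complex.mul_conj, Complex.normSq_eq_norm_sq] at h
  rw [← Real.sqrt_sq (norm_nonneg (gaussSum χ ψ))]
  congr 1
  exact_mod_cast h

end Characters

section PolyChar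

open Polynomial

variable {F : Type*} [Field F]

/-- The completely multiplicative function on monic polynomials sending `f`, with roots `r`, to
`χ (∏ r) * ψ (∑ r ^ m)`. -/
noncomputable def polyChar (m : ℕ) (χ : MulChar F ℂ) (ψ : AddChar F ℂ) (f : F[X]) : ℂ :=
  χ ((-1) ^ f.natDegree * f.coeff 0) * ψ (PowerSeries.coeff m (powerSumSeries f))

theorem polyChar_mul (m : ℕ) (χ : MulChar F ℂ) (ψ : AddChar F ℂ) (f g : F[X]) (hf : f.Monic)
    (hg : g.Monic) : polyChar m χ ψ (f * g) = polyChar m χ ψ f * polyChar m χ ψ g := by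
  simp only [polyChar]
  rw [hf.natDegree_mul hg, mul_coeff_zero, powerSumSeries_mul hf hg, map_add,
    AddChar.map_add_eq_mul, pow_add, mul_mul_mul_comm, map_mul]
  ring

theorem polyChar_one (m : ℕ) (χ : MulChar F ℂ) (ψ : AddChar F ℂ) : polyChar m χ ψ 1 = 1 := by
  simp [polyChar, powerSumSeries_one]

theorem polyChar_fieldPoly {m : ℕ} (hm : m ≠ 0) (χ : MulChar F ℂ) (ψ : AddChar F ℂ) {E : Type*}
    [Field E] [Algebra F E] [FiniteDimensional F E] [IsGalois F E] (x : E) :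
    polyChar m χ ψ (fieldPoly F x) =
      χ (Algebra.norm F x) * ψ (Algebra.trace F E (x ^ m)) := by
  rw [polyChar, coeff_zero_fieldPoly, coeff_powerSumSeries_fieldPoly F x hm]

variable [Fintype F]

theorem sum_pow_mulChar_mul_addChar {E : Type*} [Field E] [Fintype E] [Algebra F E]
    {a : ℕ} (ha : a ≠ 0) (hadvd : a ∣ Fintype.card F - 1)
    {ρ : Fin a → MulChar F ℂ} (hρ : Function.Injective ρ) (hρa : ∀ i, ρ i ^ a = 1)
    (χ : MulChar F ℂ) (ψ : AddChar F ℂ) :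
    ∑ x : E, (χ ^ a) (Algebra.norm F x) * ψ (Algebra.trace F E (x ^ a)) =
      ∑ i, ∑ x : E, (χ * ρ i) (Algebra.norm F x) * ψ (Algebra.trace F E (x ^ 1)) := by
  classical
  have h0 : ∀ (η : MulChar F ℂ) (m : ℕ),
      η (Algebra.norm F (0 : E)) * ψ (Algebra.trace F E (0 ^ m)) = 0 := by
    intro η m
    rw [Algebra.norm_zero, MulChar.map_zero, zero_mul]
  have hu : ∀ (η : MulChar F ℂ) (m : ℕ),
      ∑ x : E, η (Algebra.norm F x) * ψ (Algebra.trace F E (x ^ m)) =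
        ∑ x : Eˣ, η (Algebra.norm F (x : E)) * ψ (Algebra.trace F E ((x : E) ^ m)) :=
    fun η m => (sum_units_eq_sum (h0 η m)).symm
  simp only [hu]
  rw [Finset.sum_comm,
    ← Finset.sum_fiberwise Finset.univ (fun x : Eˣ => x ^ a)]
  refine Finset.sum_congr rfl fun y _ => ?_
  trans (χ (Algebra.norm F (y : E)) * ψ (Algebra.trace F E y)) *
    ((Finset.univ.filter fun x : Eˣ => x ^ a = y).card : ℂ)
  · rw [mul_comm, ← nsmul_eq_mul, ← Finset.sum_const]
    refine Finset.sum_congr rfl fun x hx => ?_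
    rw [← (Finset.mem_filter.1 hx).2, MulChar.pow_apply' _ ha, Units.val_pow_eq_pow_val,
      map_pow (Algebra.norm F), map_pow χ]
  · rw [← sum_mulChar_norm_eq_card_roots ha hadvd hρ hρa, Finset.mul_sum]
    refine Finset.sum_congr rfl fun i _ => ?_
    rw [MulChar.mul_apply, pow_one]
    ring

theorem extensionSeries_polyChar (p : ℕ) [Fact p.Prime] [CharP F p] {a : ℕ} (ha : a ≠ 0)
    (hadvd : a ∣ Fintype.card F - 1) {ρ : Fin a → MulChar F ℂ} (hρ : Function.Injective ρ)
    (hρa : ∀ i, ρ i ^ a = 1) (χ : MulChar F ℂ) (ψ : AddChar F ℂ) :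
    extensionSeries p (polyChar a (χ ^ a) ψ) =
      ∑ i, extensionSeries p (polyChar 1 (χ * ρ i) ψ) := by
  ext k
  rw [map_sum]
  simp only [extensionSeries, PowerSeries.coeff_mk, polyChar_fieldPoly ha,
    polyChar_fieldPoly one_ne_zero]
  exact sum_pow_mulChar_mul_addChar ha hadvd hρ hρa χ ψ

theorem monicSeries_polyChar {a : ℕ} (ha : a ≠ 0) (hadvd : a ∣ Fintype.card F - 1)
    {ρ : Fin a → MulChar F ℂ} (hρ : Function.Injective ρ) (hρa : ∀ i, ρ i ^ a = 1)
    (χ : MulChar F ℂ) (ψ : AddChar F ℂ) :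
    monicSeries (polyChar a (χ ^ a) ψ) = ∏ i, monicSeries (polyChar 1 (χ * ρ i) ψ) := by
  obtain ⟨p, hp⟩ := CharP.exists F
  have : Fact p.Prime := ⟨CharP.char_is_prime F p⟩
  refine eq_of_derivative_eq_mul (constantCoeff_monicSeries (polyChar_one _ _ _)) ?_
    (derivative_monicSeries p (polyChar_mul _ _ _)) ?_
  · rw [map_prod]
    exact Finset.prod_eq_one fun i _ => constantCoeff_monicSeries (polyChar_one _ _ _)
  · rw [extensionSeries_polyChar p ha hadvd hρ hρa]
    exact derivative_prod_eq_mul _ fun i _ => derivative_monicSeries p (polyChar_mul _ _ _)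

omit [Fintype F] in
/-- Moving the coefficient of index `n - m` by `t` changes the `m`-th power sum by `-m * t`. -/
theorem coeff_powerSumSeries_add_single {n m : ℕ} (hmn : m ≤ n) (hm : m ≠ 0) {j : Fin n}
    (hj : (j : ℕ) = n - m) (c : Fin n → F) (t : F) :
    PowerSeries.coeff m (powerSumSeries (monicOfCoeffs (c + Pi.single j t))) =
      PowerSeries.coeff m (powerSumSeries (monicOfCoeffs c)) - m * t := by
  have h := coeff_powerSumSeries_sub (monic_monicOfCoeffs (c + Pi.single j t))
    (monic_monicOfCoeffs c) (natDegree_monicOfCoeffs _) (natDegree_monicOfCoeffs _) hmn hm ?_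
  · rw [← hj, coeff_monicOfCoeffs, coeff_monicOfCoeffs, Pi.add_apply, Pi.single_eq_same] at h
    linear_combination h
  · intro i hi
    rcases lt_trichotomy i n with hin | rfl | hin
    · lift i to Fin n using hin
      have : i ≠ j := by
        rintro rfl
        omega
      rw [coeff_monicOfCoeffs, coeff_monicOfCoeffs, Pi.add_apply, Pi.single_eq_of_ne this,
        add_zero]
    · have h1 := (monic_monicOfCoeffs (c + Pi.single j t)).coeff_natDegree
      have h2 := (monic_monicOfCoeffs c).coeff_natDegree
      rw [natDegree_monicOfCoeffs] at h1 h2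
      rw [h1, h2]
    · rw [coeff_eq_zero_of_natDegree_lt, coeff_eq_zero_of_natDegree_lt] <;>
        rwa [natDegree_monicOfCoeffs]

theorem monicSeries_polyChar_one (χ : MulChar F ℂ) {ψ : AddChar F ℂ} (hψ : ψ ≠ 1) :
    monicSeries (polyChar 1 χ ψ) =
      ((1 + C (gaussSum χ ψ) * X : ℂ[X]) : PowerSeries ℂ) := by
  ext n
  rw [Polynomial.coeff_coe]
  rcases n with _ | _ | n
  · rw [PowerSeries.coeff_zero_eq_constantCoeff_apply,
      constantCoeff_monicSeries (polyChar_one _ _ _)]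
    simp
  · rw [monicSeries, PowerSeries.coeff_mk, sum_monics, gaussSum]
    have : (1 + C (∑ x, χ x * ψ x) * X : ℂ[X]).coeff (0 + 1) = ∑ x, χ x * ψ x := by
      simp [coeff_one]
    rw [this]
    refine Fintype.sum_equiv ((Equiv.funUnique (Fin 1) F).trans (Equiv.neg F)) _ _ fun c => ?_
    have hc : monicOfCoeffs c = X - C (-c 0) := by
      simp [monicOfCoeffs]
    rw [polyChar, natDegree_monicOfCoeffs, hc, powerSumSeries_X_sub_C]
    simp
  · rw [monicSeries, PowerSeries.coeff_mk, sum_monics]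
    have : (1 + C (gaussSum χ ψ) * X : ℂ[X]).coeff (n + 1 + 1) = 0 := by
      simp [coeff_one]
    rw [this]
    obtain ⟨t, ht⟩ := (AddChar.ne_one_iff).1 hψ
    refine eq_zero_of_mul_eq_self_left ht ?_
    rw [Finset.mul_sum]
    refine Fintype.sum_equiv (Equiv.addRight (Pi.single (Fin.last (n + 1)) (-t))) _ _ fun c => ?_
    have h0 : (monicOfCoeffs (c + Pi.single (Fin.last (n + 1)) (-t))).coeff 0 =
        (monicOfCoeffs c).coeff 0 := by
      have h1 := coeff_monicOfCoeffs (c + Pi.single (Fin.last (n + 1)) (-t)) 0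
      have h2 := coeff_monicOfCoeffs c 0
      rw [Pi.add_apply, Pi.single_eq_of_ne (by simp [Fin.ext_iff]), add_zero] at h1
      exact h1.trans h2.symm
    rw [Equiv.coe_addRight, polyChar, polyChar, natDegree_monicOfCoeffs, natDegree_monicOfCoeffs,
      h0, coeff_powerSumSeries_add_single (by omega) one_ne_zero (by simp), sub_eq_add_neg,
      AddChar.map_add_eq_mul]
    simp
    ring

theorem coeff_prod_one_add_C_mul_X {a : ℕ} (g : Fin a → ℂ) :
    PowerSeries.coeff a (∏ i, ((1 + C (g i) * X : ℂ[X]) : PowerSeries ℂ)) = ∏ i, g i := by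
  have h := coeff_prod_of_natDegree_le (Finset.univ : Finset (Fin a))
    (fun i => (1 + C (g i) * X : ℂ[X])) 1 fun i _ => by compute_degree
  have hc : ∏ i, ((1 + C (g i) * X : ℂ[X]) : PowerSeries ℂ) =
      ((∏ i, (1 + C (g i) * X) : ℂ[X]) : PowerSeries ℂ) := by
    simp only [← Polynomial.coeToPowerSeries.ringHom_apply, map_prod]
  rw [hc, Polynomial.coeff_coe]
  simpa [coeff_one] using h

theorem coeff_monicSeries_polyChar [DecidableEq F] {b : ℕ} (χ : MulChar F ℂ) (ψ : AddChar F ℂ) :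
    PowerSeries.coeff (b + 1) (monicSeries (polyChar (b + 1) (χ ^ (b + 1)) ψ)) =
      (∑ c : Fin b → F, ψ (PowerSeries.coeff (b + 1)
        (powerSumSeries (monicOfCoeffs (Fin.cons 0 c : Fin (b + 1) → F))))) *
      ∑ x : Fˣ, χ ((x : F) ^ (b + 1)) * ψ (((b + 1 : ℕ) : F) * (x : F)) := by
  classical
  rw [sum_units_eq_sum (f := fun x : F => χ (x ^ (b + 1)) * ψ (((b + 1 : ℕ) : F) * x))
    (by simp [MulChar.map_zero])]
  rw [monicSeries, PowerSeries.coeff_mk, sum_monics,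
    ← (Fin.consEquiv fun _ : Fin (b + 1) => F).sum_comp, Fintype.sum_prod_type, Finset.sum_comm,
    Finset.sum_mul]
  refine Finset.sum_congr rfl fun c _ => ?_
  rw [Finset.mul_sum]
  refine Fintype.sum_equiv (Equiv.neg F) _ _ fun y => ?_
  have hcons : (Fin.consEquiv fun _ : Fin (b + 1) => F) (y, c) =
      (Fin.cons 0 c : Fin (b + 1) → F) + Pi.single 0 y := by
    ext i
    refine Fin.cases ?_ (fun j => ?_) i
    · simp
    · simp
  have h0 := coeff_monicOfCoeffs ((Fin.cons 0 c : Fin (b + 1) → F) + Pi.single 0 y) 0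
  rw [Fin.val_zero] at h0
  have hsign : ((-1 : F) ^ (b + 1) * y) ^ (b + 1) = (-y) ^ (b + 1) := by
    rw [mul_pow, ← pow_mul, neg_pow y]
    congr 1
    rcases Nat.even_or_odd (b + 1) with h | h
    · rw [h.neg_one_pow, (h.mul_right _).neg_one_pow]
    · rw [h.neg_one_pow, (h.mul h).neg_one_pow]
  rw [hcons, polyChar, natDegree_monicOfCoeffs, h0,
    coeff_powerSumSeries_add_single le_rfl (Nat.succ_ne_zero b) (by simp), sub_eq_add_neg,
    AddChar.map_add_eq_mul, MulChar.pow_apply' _ (Nat.succ_ne_zero b), ← map_pow, Pi.add_apply,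
    Pi.single_eq_same, Fin.cons_zero, zero_add, hsign, Equiv.neg_apply, mul_neg]
  ring

/-- The Hasse–Davenport product relation, up to an unspecified constant. -/
theorem exists_prod_gaussSum_eq [DecidableEq F] {a : ℕ} (ha : a ≠ 0)
    (hadvd : a ∣ Fintype.card F - 1)
    {ρ : Fin a → MulChar F ℂ} (hρ : Function.Injective ρ) (hρa : ∀ i, ρ i ^ a = 1)
    {ψ : AddChar F ℂ} (hψ : ψ ≠ 1) :
    ∃ K : ℂ, ∀ χ : MulChar F ℂ, ∏ i, gaussSum (χ * ρ i) ψ =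
      K * ∑ x : Fˣ, χ ((x : F) ^ a) * ψ ((a : F) * (x : F)) := by
  obtain ⟨b, rfl⟩ := Nat.exists_eq_succ_of_ne_zero ha
  refine ⟨_, fun χ => Eq.trans ?_ (coeff_monicSeries_polyChar χ ψ)⟩
  rw [← coeff_prod_one_add_C_mul_X, monicSeries_polyChar ha hadvd hρ hρa]
  simp only [monicSeries_polyChar_one _ hψ]

end PolyChar

section Kloosterman

variable {F : Type*} [Field F] [Fintype F] [DecidableEq F]

omit [Fintype F] [DecidableEq F] in
theorem addChar_sum_eq_prod {ι : Type*} (ψ : AddChar F ℂ) (s : Finset ι) (f : ι → F) :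
    ψ (∑ i ∈ s, f i) = ∏ i ∈ s, ψ (f i) := by
  classical
  induction s using Finset.induction_on with
  | empty => simp
  | insert i s hi ih =>
    rw [Finset.sum_insert hi, Finset.prod_insert hi, AddChar.map_add_eq_mul, ih]

theorem sum_mulChar_mul_kloosterman {a : ℕ} (ρ : Fin a → MulChar F ℂ) (χ : MulChar F ℂ)
    (ψ : AddChar F ℂ) :
    ∑ u : Fˣ, χ u * (∑ x : Fin a → Fˣ, if ∏ i, x i = u then
      ψ (∑ i, (x i : F)) * ∏ i, (ρ i) ((x i : F)) else 0) = ∏ i, gaussSum (χ * ρ i) ψ := by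
  have hg : ∀ i, gaussSum (χ * ρ i) ψ = ∑ x : Fˣ, (χ * ρ i) x * ψ x := fun i =>
    (sum_units_eq_sum (f := fun x : F => (χ * ρ i) x * ψ x)
      (by rw [MulChar.map_zero, zero_mul])).symm
  simp_rw [hg, Finset.prod_univ_sum, Fintype.piFinset_univ, Finset.mul_sum]
  rw [Finset.sum_comm]
  refine Finset.sum_congr rfl fun x _ => ?_
  simp only [mul_ite, mul_zero, Finset.sum_ite_eq, Finset.mem_univ, if_true]
  rw [Units.coe_prod, map_prod, addChar_sum_eq_prod, ← Finset.prod_mul_distrib,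
    ← Finset.prod_mul_distrib]
  refine Finset.prod_congr rfl fun i _ => ?_
  rw [MulChar.mul_apply]
  ring

theorem sum_mulChar_mul_power_sum {a : ℕ} (χ : MulChar F ℂ) (h : Fˣ → ℂ) :
    ∑ u : Fˣ, χ u * (∑ x : Fˣ, if x ^ a = u then h x else 0) =
      ∑ x : Fˣ, χ ((x : F) ^ a) * h x := by
  simp_rw [Finset.mul_sum]
  rw [Finset.sum_comm]
  refine Finset.sum_congr rfl fun x _ => ?_
  simp

theorem sum_units_addChar_mul {ψ : AddChar F ℂ} (hψ : ψ ≠ 1) {b : F} (hb : b ≠ 0) :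
    ∑ x : Fˣ, ψ (b * x) = -1 := by
  have h := gaussSum_one_left hψ
  rw [gaussSum, ← sum_units_eq_sum (by rw [MulChar.map_zero, zero_mul])] at h
  rw [← h]
  refine Fintype.sum_equiv (Equiv.mulLeft (Units.mk0 b hb)) _ _ fun x => ?_
  rw [MulChar.one_apply_coe, one_mul]
  simp

omit [DecidableEq F] in
theorem norm_prod_gaussSum {a : ℕ} {ρ : Fin a → MulChar F ℂ} (hρ : Function.Injective ρ)
    (h1 : ∃ i, ρ i = 1) {ψ : AddChar F ℂ} (hψ : ψ ≠ 1) :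
    ‖∏ i, gaussSum (ρ i) ψ‖ = √(Fintype.card F) ^ (a - 1) := by
  obtain ⟨j, hj⟩ := h1
  rw [norm_prod, ← Finset.mul_prod_erase _ _ (Finset.mem_univ j), hj, gaussSum_one_left hψ,
    norm_neg, norm_one, one_mul, Finset.prod_congr rfl (g := fun _ => √(Fintype.card F)),
    Finset.prod_const, Finset.card_erase_of_mem (Finset.mem_univ j), Finset.card_univ,
    Fintype.card_fin]
  intro i hi
  refine norm_gaussSum (fun h => Finset.ne_of_mem_erase hi (hρ (h.trans hj.symm))) ?_
  exact AddChar.IsPrimitive.of_ne_one hψ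

omit [DecidableEq F] in
theorem natCast_ne_zero_of_dvd_card_sub_one {a : ℕ} (h : a ∣ Fintype.card F - 1) :
    (a : F) ≠ 0 := by
  obtain ⟨d, hd⟩ := h
  intro h0
  have h1 : ((Fintype.card F - 1 : ℕ) : F) = 0 := by rw [hd, Nat.cast_mul, h0, zero_mul]
  rw [Nat.cast_sub Fintype.card_pos, Nat.cast_card_eq_zero] at h1
  simp at h1

end Kloosterman

/-- Let `F` be a finite field of cardinality `Q`, `ψ` a nontrivial additive
character, `a ≥ 1` dividing `Q − 1` and `ρ_1, …, ρ_a` an enumeration of the multiplicative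
characters of order dividing `a`. Then there exists `c ∈ ℂ` with `|c| = 1`, depending only on
`ψ` and `a`, such that for all `u ∈ F^×`:
`−Σ_{x^a = u} ψ(a·x) = c · Q^{-(a−1)/2} · Σ_{x_1⋯x_a = u} ψ(x_1+⋯+x_a) ∏ ρ_i(x_i)`. -/
theorem power_sum_eq_generalized_kloosterman (F : Type*) [Field F] [Fintype F] [DecidableEq F]
    (ψ : AddChar F ℂ) (hψ : ∃ x : F, ψ x ≠ 1)
    (a : ℕ) (ha : 1 ≤ a) (hadvd : a ∣ Fintype.card F - 1)
    (ρ : Fin a → MulChar F ℂ)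
    (hρ_ord : ∀ i, (ρ i) ^ a = 1)
    (hρ_inj : Function.Injective ρ)
    (hρ_surj : ∀ χ : MulChar F ℂ, χ ^ a = 1 → ∃ i, ρ i = χ) :
    ∃ c : ℂ, ‖c‖ = 1 ∧ ∀ u : Fˣ,
      -(∑ x : Fˣ, if x ^ a = u then ψ ((a : F) * (x : F)) else 0) =
        c * (((Fintype.card F : ℝ) ^ (-(((a : ℝ) - 1) / 2)) : ℝ) : ℂ) *
          ∑ x : Fin a → Fˣ,
            if ∏ i, x i = u then
              ψ (∑ i, (x i : F)) * ∏ i, (ρ i) ((x i : F))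
            else 0 := by
  have hψ1 : ψ ≠ 1 := AddChar.ne_one_iff.2 hψ
  have ha0 : a ≠ 0 := by omega
  have hQ : (0 : ℝ) < Fintype.card F := Nat.cast_pos.2 Fintype.card_pos
  obtain ⟨K, hK⟩ := exists_prod_gaussSum_eq ha0 hadvd hρ_inj hρ_ord hψ1
  have hKnorm : ‖K‖ = (Fintype.card F : ℝ) ^ (((a : ℝ) - 1) / 2) := by
    have h1 := hK 1
    simp only [one_mul, ← Units.val_pow_eq_pow_val, MulChar.one_apply_coe] at h1
    rw [sum_units_addChar_mul hψ1 (natCast_ne_zero_of_dvd_card_sub_one hadvd)] at h1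
    have h2 := norm_prod_gaussSum hρ_inj (hρ_surj 1 (one_pow a)) hψ1
    rw [h1, norm_mul, norm_neg, norm_one, mul_one] at h2
    rw [h2, Real.sqrt_eq_rpow, ← Real.rpow_mul_natCast hQ.le, Nat.cast_sub ha, Nat.cast_one]
    congr 1
    ring
  set q : ℝ := (Fintype.card F : ℝ) ^ (((a : ℝ) - 1) / 2) with hq
  have hqpos : 0 < q := Real.rpow_pos_of_pos hQ _
  have hK0 : K ≠ 0 := norm_pos_iff.1 (hKnorm ▸ hqpos)
  have hq0 : (q : ℂ) ≠ 0 := Complex.ofReal_ne_zero.2 hqpos.ne'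
  refine ⟨-q / K, ?_, fun u => ?_⟩
  · rw [norm_div, norm_neg, hKnorm, Complex.norm_real, Real.norm_of_nonneg hqpos.le,
      div_self hqpos.ne']
  · have key := eq_zero_of_forall_sum_mulChar_mul (h := fun u : Fˣ =>
      (∑ x : Fin a → Fˣ, if ∏ i, x i = u then
        ψ (∑ i, (x i : F)) * ∏ i, (ρ i) ((x i : F)) else 0) -
      K * ∑ x : Fˣ, if x ^ a = u then ψ ((a : F) * (x : F)) else 0) (fun χ => ?_) u
    · rw [sub_eq_zero.1 key, Real.rpow_neg hQ.le, ← hq, Complex.ofReal_inv]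
      field_simp
    · simp only [mul_sub, mul_left_comm _ K, Finset.sum_sub_distrib, ← Finset.mul_sum]
      rw [sum_mulChar_mul_kloosterman, sum_mulChar_mul_power_sum, hK, sub_self]
end

section
/- Let a be a nonzero integer and let b be an integer with b ≤ −3 or b ≥ 1. Let l ≥ 2 be an integer, and if b ≤ −3 assume additionally l ≤ −b. For every ε > 0 there exists C > 0 such that the following holds for every prime q: for all positive integers M, N with q^{1/l} ≤ N/10, M < q, N < q and N² < q^{1+1/l}, for every integer ξ coprime to q, for every sequence of complex numbers (α_m)_{M < m ≤ 2M}, and for every set 𝒩 of N consecutive integers, one has |Σ_{M < m ≤ 2M, gcd(m,q)=1} α_m Σ_{n ∈ 𝒩, gcd(n,q)=1} e^{2πi (ξ m^{-a} n^{-b} mod q)/q}| ≤ C · q^ε · (Σ_{m} |α_m|²)^{1/2} · M^{1/2} · N · (q^{1+1/l}/(M N²))^{1/(2l)}. -/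
open scoped Real

/-- The standard additive character `t ↦ e^{2πi t/q}` on `ZMod q`. -/
noncomputable def eZMod (q : ℕ) (t : ZMod q) : ℂ :=
  Complex.exp (2 * Real.pi * Complex.I * (t.val : ℂ) / q)

lemma card_divisors_le_rpow (ε : ℝ) (hε : 0 < ε) :
    ∃ C : ℝ, 0 < C ∧ ∀ n : ℕ, n ≠ 0 → (n.divisors.card : ℝ) ≤ C * (n : ℝ) ^ ε := by
  set K : ℝ := max 1 (1 / (ε * Real.log 2)) with hK
  set P : ℕ := ⌈(2 : ℝ) ^ (1 / ε)⌉₊ with hP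
  have hl2 : 0 < ε * Real.log 2 := mul_pos hε (Real.log_pos one_lt_two)
  have hK1 : 1 ≤ K := le_max_left _ _
  have hK0 : 0 < K := by linarith
  refine ⟨K ^ P, by positivity, fun n hn => ?_⟩
  have hloc : ∀ p ∈ n.primeFactors, ((n.factorization p + 1 : ℕ) : ℝ) ≤
      (if p < P then K else 1) * ((p : ℝ) ^ (n.factorization p)) ^ ε := by
    intro p hp
    have hp2 : (2 : ℝ) ≤ p := by exact_mod_cast (Nat.prime_of_mem_primeFactors hp).two_le
    set k := n.factorization p
    have e1 : ((p : ℝ) ^ k) ^ ε = ((p : ℝ) ^ ε) ^ k := by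
      rw [← Real.rpow_natCast, ← Real.rpow_mul (by linarith), mul_comm,
        Real.rpow_mul (by linarith), Real.rpow_natCast]
    rw [e1]
    push_cast
    split_ifs with h
    · have h1 : (1 : ℝ) + ε * Real.log 2 ≤ (p : ℝ) ^ ε := by
        calc (1 : ℝ) + ε * Real.log 2 ≤ Real.exp (ε * Real.log 2) := by
              linarith [Real.add_one_le_exp (ε * Real.log 2)]
          _ = (2 : ℝ) ^ ε := by rw [Real.rpow_def_of_pos two_pos, mul_comm]
          _ ≤ (p : ℝ) ^ ε := by gcongr
      have h2 : (1 : ℝ) + k * (ε * Real.log 2) ≤ ((p : ℝ) ^ ε) ^ k :=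
        (one_add_mul_le_pow (by linarith) k).trans (by gcongr)
      have h3 : 1 ≤ K * (ε * Real.log 2) := by
        calc (1 : ℝ) = (1 / (ε * Real.log 2)) * (ε * Real.log 2) := by field_simp
          _ ≤ _ := by gcongr; exact le_max_right _ _
      have hk : (0 : ℝ) ≤ k := by positivity
      nlinarith [mul_le_mul_of_nonneg_left h2 hK0.le]
    · rw [one_mul]
      have h1 : (2 : ℝ) ≤ (p : ℝ) ^ ε := by
        have : (2 : ℝ) ^ (1 / ε) ≤ p := (Nat.le_ceil _).trans (by exact_mod_cast not_lt.mp h)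
        calc (2 : ℝ) = ((2 : ℝ) ^ (1 / ε)) ^ ε := by
              rw [← Real.rpow_mul two_pos.le, one_div_mul_cancel hε.ne', Real.rpow_one]
          _ ≤ _ := by gcongr
      calc (k : ℝ) + 1 = 1 + k * 1 := by ring
        _ ≤ (1 + 1) ^ k := one_add_mul_le_pow (by norm_num) k
        _ ≤ _ := by gcongr; linarith
  rw [Nat.card_divisors hn, Nat.cast_prod]
  calc _ ≤ ∏ p ∈ n.primeFactors, (if p < P then K else 1) * ((p : ℝ) ^ (n.factorization p)) ^ ε :=
        Finset.prod_le_prod (fun _ _ => by positivity) hloc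
    _ = (∏ p ∈ n.primeFactors, (if p < P then K else 1)) * (n : ℝ) ^ ε := by
        rw [Finset.prod_mul_distrib, Real.finsetProd_rpow _ _ (fun _ _ => by positivity)]
        congr 2
        conv_rhs => rw [← Nat.prod_factorization_pow_eq_self hn]
        simp [Finsupp.prod]
    _ ≤ _ := by
        gcongr
        rw [Finset.prod_ite, Finset.prod_const, Finset.prod_const_one, mul_one]
        apply pow_le_pow_right₀ hK1
        calc _ ≤ (Finset.range P).card := Finset.card_le_card (fun x hx => by
              simpa using (Finset.mem_filter.mp hx).2)
          _ = P := by simp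

section Count
variable {q : ℕ} [Fact q.Prime]

lemma card_filter_sum_inv_pow_eq_le (k l : ℕ) (hk : 1 ≤ k) (hlq : l < q)
    (v w : Fin l → ZMod q) (hne : ∃ i, ∀ j, w i ≠ v j) :
    (Finset.univ.filter fun r : ZMod q =>
      ∑ i, ((r + v i) ^ k)⁻¹ = ∑ i, ((r + w i) ^ k)⁻¹).card ≤ 2 * l + 2 * l * k := by
  classical
  obtain ⟨i₀, hi₀⟩ := hne
  set S : Finset (ZMod q) := Finset.univ.image v ∪ Finset.univ.image w with hS
  have hScard : S.card ≤ 2 * l := by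
    refine (Finset.card_union_le _ _).trans ?_
    have h1 := Finset.card_image_le (s := Finset.univ) (f := v)
    have h2 := Finset.card_image_le (s := Finset.univ) (f := w)
    simp only [Finset.card_univ, Fintype.card_fin] at h1 h2
    omega
  have hvS : ∀ i, v i ∈ S := fun i => by simp [hS]
  have hwS : ∀ i, w i ∈ S := fun i => by simp [hS]
  let T : ZMod q → Polynomial (ZMod q) := fun x =>
    ∏ y ∈ S.erase x, (Polynomial.X + Polynomial.C y) ^ k
  set Q : Polynomial (ZMod q) := ∑ i, T (v i) - ∑ i, T (w i) with hQ
  have hTe : ∀ x r, (T x).eval r = ∏ y ∈ S.erase x, (r + y) ^ k := fun x r => by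
    simp [T, Polynomial.eval_prod]
  have hT0 : ∀ x, x ≠ w i₀ → (T x).eval (- w i₀) = 0 := by
    intro x hx
    rw [hTe]
    refine Finset.prod_eq_zero (Finset.mem_erase.mpr ⟨hx.symm, hwS i₀⟩) ?_
    simp; omega
  have hT1 : (T (w i₀)).eval (- w i₀) ≠ 0 := by
    rw [hTe, Finset.prod_ne_zero_iff]
    intro y hy
    refine pow_ne_zero _ ?_
    have := (Finset.mem_erase.mp hy).1
    intro h
    exact this (by linear_combination h)
  have hQ0 : Q ≠ 0 := by
    intro h
    have h1 : Q.eval (- w i₀) = 0 := by rw [h]; simp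
    rw [hQ, Polynomial.eval_sub, Polynomial.eval_finsetSum, Polynomial.eval_finsetSum,
      Finset.sum_eq_zero (fun i _ => hT0 (v i) (hi₀ i).symm), zero_sub, neg_eq_zero] at h1
    have h2 : ∀ i, (T (w i)).eval (- w i₀) =
        if w i = w i₀ then (T (w i₀)).eval (- w i₀) else 0 := by
      intro i
      split_ifs with h
      · rw [h]
      · exact hT0 _ h
    rw [Finset.sum_congr rfl (fun i _ => h2 i), ← Finset.sum_filter, Finset.sum_const,
      nsmul_eq_mul, mul_eq_zero, or_iff_left hT1, ZMod.natCast_eq_zero_iff] at h1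
    have h3 := Nat.le_of_dvd (Finset.card_pos.mpr ⟨i₀, by simp⟩) h1
    have h4 := Finset.card_filter_le (Finset.univ) (fun i => w i = w i₀)
    simp only [Finset.card_univ, Fintype.card_fin] at h4
    omega
  have hTdeg : ∀ x, (T x).natDegree ≤ 2 * l * k := by
    intro x
    refine (Polynomial.natDegree_prod_le _ _).trans ?_
    refine (Finset.sum_le_card_nsmul _ _ k ?_).trans ?_
    · intro y _
      refine Polynomial.natDegree_pow_le.trans ?_
      simp
    · rw [smul_eq_mul]
      exact Nat.mul_le_mul_right _ ((Finset.card_le_card (Finset.erase_subset _ _)).trans hScard)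
  have hQdeg : Q.natDegree ≤ 2 * l * k := by
    refine (Polynomial.natDegree_sub_le _ _).trans (max_le ?_ ?_)
    · exact Polynomial.natDegree_sum_le_of_forall_le _ _ fun i _ => hTdeg _
    · exact Polynomial.natDegree_sum_le_of_forall_le _ _ fun i _ => hTdeg _
  have hsub : (Finset.univ.filter fun r : ZMod q =>
      ∑ i, ((r + v i) ^ k)⁻¹ = ∑ i, ((r + w i) ^ k)⁻¹) ⊆
      S.image (fun y => -y) ∪ Q.roots.toFinset := by
    intro r hr
    rw [Finset.mem_filter] at hr
    by_cases hrS : r ∈ S.image (fun y => -y)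
    · exact Finset.mem_union_left _ hrS
    refine Finset.mem_union_right _ ?_
    rw [Multiset.mem_toFinset, Polynomial.mem_roots hQ0, Polynomial.IsRoot.def, hQ,
      Polynomial.eval_sub, Polynomial.eval_finsetSum, Polynomial.eval_finsetSum]
    have hnz : ∀ y ∈ S, (r + y) ^ k ≠ 0 := by
      intro y hy
      refine pow_ne_zero _ fun h => hrS ?_
      exact Finset.mem_image.mpr ⟨y, hy, by linear_combination -h⟩
    have hTx : ∀ x ∈ S, (T x).eval r = (∏ y ∈ S, (r + y) ^ k) * ((r + x) ^ k)⁻¹ := by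
      intro x hx
      rw [hTe, ← Finset.mul_prod_erase S _ hx]
      have := hnz x hx
      field_simp
    rw [Finset.sum_congr rfl (fun i _ => hTx _ (hvS i)),
      Finset.sum_congr rfl (fun i _ => hTx _ (hwS i)), ← Finset.mul_sum, ← Finset.mul_sum, hr.2,
      sub_self]
  refine (Finset.card_le_card hsub).trans ((Finset.card_union_le _ _).trans ?_)
  refine Nat.add_le_add (Finset.card_image_le.trans hScard) ?_
  exact (Multiset.toFinset_card_le _).trans ((Polynomial.card_roots' _).trans hQdeg)

lemma exists_eq_of_psum_eq (l : ℕ) (hlq : l < q) (v w : Fin l → ZMod q)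
    (h : ∀ j ≤ l, ∑ i, v i ^ j = ∑ i, w i ^ j) (i : Fin l) : ∃ j, w i = v j := by
  classical
  have hes : ∀ k ≤ l, MvPolynomial.aeval v (MvPolynomial.esymm (Fin l) (ZMod q) k) =
      MvPolynomial.aeval w (MvPolynomial.esymm (Fin l) (ZMod q) k) := by
    intro k
    induction k using Nat.strong_induction_on with
    | _ k ih =>
      intro hk
      rcases Nat.eq_zero_or_pos k with rfl | hk0
      · simp
      have hkq : (k : ZMod q) ≠ 0 := by
        rw [Ne, ZMod.natCast_eq_zero_iff]
        exact fun hd => absurd (Nat.le_of_dvd hk0 hd) (by omega)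
      have key := MvPolynomial.mul_esymm_eq_sum (Fin l) (ZMod q) k
      have kv := congrArg (MvPolynomial.aeval v) key
      have kw := congrArg (MvPolynomial.aeval w) key
      simp only [map_mul, map_sum, map_pow, map_neg, map_one, map_natCast] at kv kw
      apply mul_left_cancel₀ hkq
      rw [kv, kw]
      congr 1
      refine Finset.sum_congr rfl fun a ha => ?_
      rw [Finset.mem_filter, Finset.HasAntidiagonal.mem_antidiagonal] at ha
      rw [ih a.1 ha.2 (by omega)]
      congr 1
      simp only [MvPolynomial.psum, map_sum, map_pow, MvPolynomial.aeval_X]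
      exact h _ (by omega)
  have hp : ∏ j, (w i - v j) = ∏ j, (w i - w j) := by
    have expand : ∀ u : Fin l → ZMod q, ∏ j, (Polynomial.X - Polynomial.C (u j)) =
        ∑ k ∈ Finset.range (l + 1), (-1) ^ k *
          (Polynomial.C (MvPolynomial.aeval u (MvPolynomial.esymm (Fin l) (ZMod q) k)) *
            Polynomial.X ^ (l - k)) := by
      intro u
      have := Multiset.prod_X_sub_X_eq_sum_esymm (Finset.univ.val.map u)
      simp only [Multiset.map_map, Multiset.card_map, Finset.card_val, Finset.card_univ,
        Fintype.card_fin] at this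
      simp only [MvPolynomial.aeval_esymm_eq_multiset_esymm]
      exact this
    have : ∏ j, (Polynomial.X - Polynomial.C (v j)) = ∏ j, (Polynomial.X - Polynomial.C (w j)) := by
      rw [expand, expand]
      refine Finset.sum_congr rfl fun k hk => ?_
      rw [hes k (by simpa [Nat.lt_succ_iff] using hk)]
    have := congrArg (Polynomial.eval (w i)) this
    simpa [Polynomial.eval_prod] using this
  replace hp := hp.trans (Finset.prod_eq_zero (Finset.mem_univ i) (sub_self (w i)))
  rw [Finset.prod_eq_zero_iff] at hp
  obtain ⟨j, -, hj⟩ := hp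
  exact ⟨j, sub_eq_zero.mp hj⟩

lemma card_filter_sum_pow_eq_le (k l : ℕ) (hlk : l ≤ k) (hkq : k < q)
    (v w : Fin l → ZMod q) (hne : ∃ i, ∀ j, w i ≠ v j) :
    (Finset.univ.filter fun r : ZMod q =>
      ∑ i, (r + v i) ^ k = ∑ i, (r + w i) ^ k).card ≤ k := by
  classical
  set Q : Polynomial (ZMod q) := ∑ i, (Polynomial.X + Polynomial.C (v i)) ^ k -
    ∑ i, (Polynomial.X + Polynomial.C (w i)) ^ k with hQ
  have hQ0 : Q ≠ 0 := by
    intro h0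
    obtain ⟨i₀, hi₀⟩ := hne
    obtain ⟨j, hj⟩ := exists_eq_of_psum_eq l (by omega) v w (fun j hj => by
      have := congrArg (fun P => Polynomial.coeff P (k - j)) h0
      simp only [hQ, Polynomial.coeff_sub, Polynomial.finsetSum_coeff,
        Polynomial.coeff_X_add_C_pow, Polynomial.coeff_zero, ← Finset.sum_mul, ← sub_mul] at this
      rw [Nat.sub_sub_self (by omega), mul_eq_zero] at this
      refine sub_eq_zero.mp (this.resolve_right ?_)
      rw [ZMod.natCast_eq_zero_iff]
      intro hd
      have : q ∣ k.factorial := by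
        rw [← Nat.choose_mul_factorial_mul_factorial (Nat.sub_le k j), mul_assoc]
        exact hd.mul_right _
      exact absurd ((Nat.Prime.dvd_factorial (Fact.out)).mp this) (by omega)) i₀
    exact hi₀ j hj
  have hdeg : ∀ u : Fin l → ZMod q,
      (∑ i, (Polynomial.X + Polynomial.C (u i)) ^ k).natDegree ≤ k := by
    intro u
    refine Polynomial.natDegree_sum_le_of_forall_le _ _ fun i _ => ?_
    refine Polynomial.natDegree_pow_le.trans ?_
    simp
  have hsub : (Finset.univ.filter fun r : ZMod q =>
      ∑ i, (r + v i) ^ k = ∑ i, (r + w i) ^ k) ⊆ Q.roots.toFinset := by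
    intro r hr
    rw [Finset.mem_filter] at hr
    rw [Multiset.mem_toFinset, Polynomial.mem_roots hQ0, Polynomial.IsRoot.def, hQ]
    simp [Polynomial.eval_finsetSum, hr.2]
  refine (Finset.card_le_card hsub).trans ((Multiset.toFinset_card_le _).trans
    ((Polynomial.card_roots' _).trans ?_))
  exact (Polynomial.natDegree_sub_le _ _).trans (max_le (hdeg v) (hdeg w))

lemma card_filter_sum_zpow_eq_le (b : ℤ) (l : ℕ) (hb : b ≤ -3 ∨ 1 ≤ b)
    (hlb : b ≤ -3 → (l : ℤ) ≤ -b) (hlq : l < q) (hbq : b.natAbs < q)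
    (v w : Fin l → ZMod q) (hne : ∃ i, ∀ j, w i ≠ v j) :
    (Finset.univ.filter fun r : ZMod q =>
      ∑ i, (r + v i) ^ (-b) = ∑ i, (r + w i) ^ (-b)).card ≤ (2 * l + 1) * (b.natAbs + 1) := by
  rcases hb with hb | hb
  · obtain ⟨k, hk⟩ : ∃ k : ℕ, -b = k := ⟨b.natAbs, by omega⟩
    have hkb : b.natAbs = k := by omega
    simp only [hk, zpow_natCast, hkb]
    refine (card_filter_sum_pow_eq_le k l (by have := hlb hb; omega) (by omega) v w hne).trans ?_
    nlinarith
  · obtain ⟨k, hk⟩ : ∃ k : ℕ, b = k := ⟨b.natAbs, by omega⟩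
    subst hk
    simp only [zpow_neg, zpow_natCast, Int.natAbs_natCast]
    refine (card_filter_sum_inv_pow_eq_le k l (by omega) hlq v w hne).trans ?_
    nlinarith

end Count

lemma addChar_map_sum {A R ι : Type*} [AddCommMonoid A] [CommMonoid R] (ψ : AddChar A R)
    (s : Finset ι) (f : ι → A) : ψ (∑ i ∈ s, f i) = ∏ i ∈ s, ψ (f i) := by
  classical
  induction s using Finset.induction_on with
  | empty => simp
  | insert i s hi ih => rw [Finset.sum_insert hi, Finset.prod_insert hi, AddChar.map_add_eq_mul, ih]

lemma sum_norm_pow_le_card {q : ℕ} [Fact q.Prime] {ι : Type*} [DecidableEq ι] (l : ℕ)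
    (V : Finset ι) (c : ι → ℂ) (hc : ∀ x, ‖c x‖ ≤ 1) (f : ι → ZMod q) :
    ∑ s : ZMod q, ‖∑ x ∈ V, c x * ZMod.stdAddChar (s * f x)‖ ^ (2 * l) ≤
      q * (((Fintype.piFinset fun _ : Fin l => V) ×ˢ (Fintype.piFinset fun _ : Fin l => V)).filter
        fun p => ∑ i, f (p.1 i) = ∑ i, f (p.2 i)).card := by
  classical
  set Pi := Fintype.piFinset fun _ : Fin l => V
  set W : (Fin l → ι) → ℂ := fun p => ∏ i, c (p i) with hW
  have hW1 : ∀ p, ‖W p‖ ≤ 1 := fun p => by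
    rw [hW, norm_prod]
    exact Finset.prod_le_one (fun _ _ => norm_nonneg _) (fun _ _ => hc _)
  have hpow : ∀ s : ZMod q, (∑ x ∈ V, c x * ZMod.stdAddChar (s * f x)) ^ l =
      ∑ p ∈ Pi, W p * ZMod.stdAddChar (s * ∑ i, f (p i)) := by
    intro s
    have := Finset.prod_univ_sum (fun _ : Fin l => V)
      (fun _ x => c x * ZMod.stdAddChar (s * f x))
    rw [Finset.prod_const, Finset.card_univ, Fintype.card_fin] at this
    rw [this]
    refine Finset.sum_congr rfl fun p _ => ?_
    rw [Finset.prod_mul_distrib, Finset.mul_sum, addChar_map_sum]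
  have hterm : ∀ s : ZMod q, ((‖∑ x ∈ V, c x * ZMod.stdAddChar (s * f x)‖ ^ (2 * l) : ℝ) : ℂ) =
      ∑ p ∈ Pi ×ˢ Pi, W p.1 * (starRingEnd ℂ) (W p.2) *
        ZMod.stdAddChar (s * (∑ i, f (p.1 i) - ∑ i, f (p.2 i))) := by
    intro s
    rw [Complex.ofReal_pow, pow_mul, ← Complex.mul_conj', mul_pow, ← map_pow, hpow, map_sum,
      Finset.sum_mul_sum, ← Finset.sum_product']
    refine Finset.sum_congr rfl fun p _ => ?_
    rw [map_mul (starRingEnd ℂ), ← AddChar.map_neg_eq_conj, mul_sub, sub_eq_add_neg,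
      AddChar.map_add_eq_mul]
    ring
  have hsum : ((∑ s : ZMod q, ‖∑ x ∈ V, c x * ZMod.stdAddChar (s * f x)‖ ^ (2 * l) : ℝ) : ℂ) =
      ∑ p ∈ Pi ×ˢ Pi, W p.1 * (starRingEnd ℂ) (W p.2) *
        (if ∑ i, f (p.1 i) = ∑ i, f (p.2 i) then (q : ℂ) else 0) := by
    rw [Complex.ofReal_sum, Finset.sum_congr rfl (fun s _ => hterm s), Finset.sum_comm]
    refine Finset.sum_congr rfl fun p _ => ?_
    rw [← Finset.mul_sum, AddChar.sum_mulShift _ (ZMod.isPrimitive_stdAddChar q)]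
    simp [sub_eq_zero, ZMod.card]
  have h0 : 0 ≤ ∑ s : ZMod q, ‖∑ x ∈ V, c x * ZMod.stdAddChar (s * f x)‖ ^ (2 * l) := by
    positivity
  rw [← abs_of_nonneg h0, ← Real.norm_eq_abs, ← Complex.norm_real, hsum, mul_comm,
    ← nsmul_eq_mul, ← Finset.sum_const, Finset.sum_filter]
  refine (norm_sum_le _ _).trans (Finset.sum_le_sum fun p _ => ?_)
  rw [norm_mul, norm_mul, RCLike.norm_conj]
  have h1 : ‖W p.1‖ * ‖W p.2‖ ≤ 1 := mul_le_one₀ (hW1 _) (norm_nonneg _) (hW1 _)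
  split_ifs
  · rw [Complex.norm_natCast]
    exact mul_le_of_le_one_left (by positivity) h1
  · simp

lemma card_product_filter_forall_exists_le {ι : Type*} [DecidableEq ι] (l : ℕ) (V : Finset ι) :
    (((Fintype.piFinset fun _ : Fin l => V) ×ˢ (Fintype.piFinset fun _ : Fin l => V)).filter
        fun p => ∀ i, ∃ j, p.2 i = p.1 j).card ≤ V.card ^ l * l ^ l := by
  classical
  have hsub : (((Fintype.piFinset fun _ : Fin l => V) ×ˢ
      (Fintype.piFinset fun _ : Fin l => V)).filter fun p => ∀ i, ∃ j, p.2 i = p.1 j) ⊆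
      ((Fintype.piFinset fun _ : Fin l => V) ×ˢ (Finset.univ : Finset (Fin l → Fin l))).image
        (fun p => (p.1, fun i => p.1 (p.2 i))) := by
    intro p hp
    rw [Finset.mem_filter, Finset.mem_product] at hp
    choose τ hτ using hp.2
    refine Finset.mem_image.mpr ⟨(p.1, τ), by simpa using hp.1.1, ?_⟩
    ext i
    · rfl
    · exact (hτ i).symm
  refine (Finset.card_le_card hsub).trans (Finset.card_image_le.trans ?_)
  simp [Finset.card_product]

/-- Mean value estimate for the complete sums over dilations and translations. -/
lemma exists_sum_norm_pow_le (b : ℤ) (l : ℕ) (hb : b ≤ -3 ∨ 1 ≤ b)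
    (hlb : b ≤ -3 → (l : ℤ) ≤ -b) :
    ∃ C : ℝ, 0 < C ∧ ∀ (q : ℕ) [Fact q.Prime] (V : Finset (ZMod q)), V.card ^ l ≤ q →
      ∀ c : ZMod q → ZMod q → ℂ, (∀ r x, ‖c r x‖ ≤ 1) →
        ∑ r : ZMod q, ∑ s : ZMod q,
          ‖∑ x ∈ V, c r x * ZMod.stdAddChar (s * (r + x) ^ (-b))‖ ^ (2 * l) ≤
            C * q ^ 2 * V.card ^ l := by
  classical
  set D : ℕ := l ^ l + (2 * l + 1) * (b.natAbs + 1) + (l + b.natAbs) with hD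
  have hD0 : 0 < D := by rw [hD]; positivity
  refine ⟨D, by exact_mod_cast hD0, fun q _ V hV c hc => ?_⟩
  set Pi := (Fintype.piFinset fun _ : Fin l => V) ×ˢ (Fintype.piFinset fun _ : Fin l => V)
  have hPi : Pi.card = V.card ^ l * V.card ^ l := by simp [Pi, Finset.card_product]
  have hcount : ∑ r : ZMod q, (Pi.filter fun p =>
      ∑ i, (r + p.1 i) ^ (-b) = ∑ i, (r + p.2 i) ^ (-b)).card ≤ D * q * V.card ^ l := by
    simp only [Finset.card_filter]
    rw [Finset.sum_comm]
    simp only [← Finset.card_filter]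
    have htriv : ∀ p : (Fin l → ZMod q) × (Fin l → ZMod q), (Finset.univ.filter fun r : ZMod q =>
        ∑ i, (r + p.1 i) ^ (-b) = ∑ i, (r + p.2 i) ^ (-b)).card ≤ q := fun p =>
      (Finset.card_filter_le _ _).trans (by simp [ZMod.card])
    by_cases hsmall : q ≤ l + b.natAbs
    · calc _ ≤ Pi.card * q := by
            rw [← smul_eq_mul]; exact Finset.sum_le_card_nsmul _ _ _ fun p _ => htriv p
        _ ≤ V.card ^ l * q * q := by rw [hPi]; gcongr
        _ ≤ V.card ^ l * q * D := by gcongr; omega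
        _ = _ := by ring
    · rw [← Finset.sum_filter_add_sum_filter_not Pi (fun p => ∀ i, ∃ j, p.2 i = p.1 j)]
      have h1 := Finset.sum_le_card_nsmul (Pi.filter fun p => ∀ i, ∃ j, p.2 i = p.1 j) _ q
        fun p _ => htriv p
      have h2 := Finset.sum_le_card_nsmul (Pi.filter fun p => ¬ ∀ i, ∃ j, p.2 i = p.1 j)
        (fun p => (Finset.univ.filter fun r : ZMod q =>
          ∑ i, (r + p.1 i) ^ (-b) = ∑ i, (r + p.2 i) ^ (-b)).card)
        ((2 * l + 1) * (b.natAbs + 1)) fun p hp => by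
          have := (Finset.mem_filter.mp hp).2
          push Not at this
          exact card_filter_sum_zpow_eq_le b l hb hlb (by omega) (by omega) _ _ this
      refine (Nat.add_le_add h1 h2).trans ?_
      simp only [smul_eq_mul]
      calc _ ≤ (V.card ^ l * l ^ l) * q +
            (V.card ^ l * V.card ^ l) * ((2 * l + 1) * (b.natAbs + 1)) := by
              gcongr
              · exact card_product_filter_forall_exists_le l V
              · rw [← hPi]; exact Finset.card_filter_le _ _
        _ ≤ (V.card ^ l * l ^ l) * q + (V.card ^ l * q) * ((2 * l + 1) * (b.natAbs + 1)) := by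
              gcongr
        _ = (l ^ l + (2 * l + 1) * (b.natAbs + 1)) * q * V.card ^ l := by ring
        _ ≤ _ := by gcongr; omega
  calc _ ≤ ∑ r : ZMod q, (q : ℝ) * ((Pi.filter fun p =>
      ∑ i, (r + p.1 i) ^ (-b) = ∑ i, (r + p.2 i) ^ (-b)).card : ℝ) :=
        Finset.sum_le_sum fun r _ => sum_norm_pow_le_card l V (c r) (hc r) fun x => (r + x) ^ (-b)
    _ = q * ((∑ r : ZMod q, (Pi.filter fun p =>
      ∑ i, (r + p.1 i) ^ (-b) = ∑ i, (r + p.2 i) ^ (-b)).card : ℕ) : ℝ) := by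
        rw [← Finset.mul_sum, Nat.cast_sum]
    _ ≤ q * ((D * q * V.card ^ l : ℕ) : ℝ) := by gcongr
    _ = _ := by push_cast; ring

/-- Completion: incomplete sums over subintervals of `[0, B)` are controlled by
a fixed weighted average, of logarithmic mass, of twisted complete sums. -/
lemma exists_completion (B : ℕ) (hB : 0 < B) :
    ∃ (c : ℕ → ℝ) (η : ℕ → ℕ → ℂ), (∀ h, 0 ≤ c h) ∧ (∀ h v, ‖η h v‖ ≤ 1) ∧
      ∑ h ∈ Finset.range B, c h ≤ 2 + Real.log B ∧
      ∀ (g : ℕ → ℂ) (m n : ℕ), n ≤ B → ‖∑ v ∈ Finset.Ico m n, g v‖ ≤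
        ∑ h ∈ Finset.range B, c h * ‖∑ v ∈ Finset.range B, η h v * g v‖ := by
  set ζ : ℂ := Complex.exp (2 * π * Complex.I / B) with hζ
  have hprim : IsPrimitiveRoot ζ B := Complex.isPrimitiveRoot_exp B hB.ne'
  have hζ1 : ‖ζ‖ = 1 := hprim.norm'_eq_one hB.ne'
  have hζ0 : ζ ≠ 0 := hprim.ne_zero hB.ne'
  have hBR : (0 : ℝ) < B := by exact_mod_cast hB
  set c : ℕ → ℝ := fun h => if h = 0 then 1 else (1 / h + 1 / (B - h : ℕ)) / 2 with hcdef
  have hc0 : ∀ h, 0 ≤ c h := fun h => by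
    simp only [hcdef]; split_ifs <;> positivity
  refine ⟨c, fun h v => ζ ^ (h * v), hc0, fun h v => by simp [hζ1], ?_, ?_⟩
  · obtain ⟨P, rfl⟩ : ∃ P, B = P + 1 := ⟨B - 1, by omega⟩
    rw [Finset.sum_range_succ']
    have h1 : ∑ h ∈ Finset.range P, c (h + 1) = (harmonic P : ℝ) := by
      have e1 : ∀ h ∈ Finset.range P, c (h + 1) =
          (1 / ((h : ℝ) + 1)) / 2 + (1 / (((P - 1 - h : ℕ) : ℝ) + 1)) / 2 := by
        intro h hh
        rw [Finset.mem_range] at hh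
        have : P + 1 - (h + 1) = (P - 1 - h) + 1 := by omega
        simp only [hcdef, this]
        push_cast
        simp [add_div]
      rw [Finset.sum_congr rfl e1, Finset.sum_add_distrib,
        Finset.sum_range_reflect (fun h => (1 / ((h : ℝ) + 1)) / 2) P, harmonic]
      push_cast
      rw [← Finset.sum_add_distrib]
      exact Finset.sum_congr rfl fun h _ => by rw [add_halves, one_div]
    have h2 := harmonic_le_one_add_log P
    have h3 : Real.log P ≤ Real.log (P + 1 : ℕ) := by
      rcases Nat.eq_zero_or_pos P with rfl | hP
      · simp
      · apply Real.log_le_log (by exact_mod_cast hP); push_cast; linarith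
    rw [h1]
    simp only [hcdef, if_true]
    linarith
  · intro g m n hn
    have horth : ∀ v ∈ Finset.range B, ∀ w ∈ Finset.range B,
        ∑ h ∈ Finset.range B, (ζ⁻¹) ^ (h * w) * ζ ^ (h * v) = if v = w then (B : ℂ) else 0 := by
      intro v hv w hw
      rw [Finset.mem_range] at hv hw
      have e : ∀ h ∈ Finset.range B, (ζ⁻¹) ^ (h * w) * ζ ^ (h * v) =
          (ζ ^ v / ζ ^ w) ^ h := fun h _ => by
        rw [div_pow, inv_pow, ← pow_mul, ← pow_mul, mul_comm v, mul_comm w]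
        field_simp
      rw [Finset.sum_congr rfl e]
      split_ifs with hvw
      · subst hvw
        simp [hζ0]
      · have hne : ζ ^ v / ζ ^ w ≠ 1 := by
          intro h
          rw [div_eq_one_iff_eq (pow_ne_zero _ hζ0)] at h
          exact hvw (hprim.pow_inj hv hw h)
        have hx : (ζ ^ v / ζ ^ w) ^ B = 1 := by
          rw [div_pow, ← pow_mul, ← pow_mul, mul_comm, pow_mul, mul_comm w, pow_mul,
            hprim.pow_eq_one]
          simp
        rw [geom_sum_eq hne, hx]
        simp
    have hcoef : ∀ h ∈ Finset.range B,
        ‖(1 / B : ℂ) * ∑ w ∈ Finset.Ico m n, (ζ⁻¹) ^ (h * w)‖ ≤ c h := by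
      intro h hh
      rw [Finset.mem_range] at hh
      rw [norm_mul, norm_div, norm_one, Complex.norm_natCast]
      by_cases h0 : h = 0
      · subst h0
        simp only [hcdef, if_true, zero_mul, pow_zero, Finset.sum_const, nsmul_eq_mul, mul_one,
          Nat.card_Ico, Complex.norm_natCast]
        rw [one_div, inv_mul_le_one₀ hBR]
        exact_mod_cast (Nat.sub_le _ _).trans hn
      simp only [hcdef, if_neg h0]
      have hne : (ζ⁻¹) ^ h ≠ 1 := by
        rw [inv_pow, Ne, inv_eq_one]
        exact hprim.pow_ne_one_of_pos_of_lt h0 hh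
      rcases le_or_gt n m with hmn | hmn
      · rw [Finset.Ico_eq_empty_of_le hmn]
        simp; positivity
      have hgeom : ‖∑ w ∈ Finset.Ico m n, (ζ⁻¹) ^ (h * w)‖ ≤ 2 / ‖ζ ^ h - 1‖ := by
        simp only [pow_mul]
        rw [geom_sum_Ico hne hmn.le, norm_div]
        have e : ‖(ζ⁻¹) ^ h - 1‖ = ‖ζ ^ h - 1‖ := by
          have : (ζ⁻¹) ^ h - 1 = -((ζ⁻¹) ^ h * (ζ ^ h - 1)) := by
            rw [inv_pow]; field_simp [pow_ne_zero h hζ0]; ring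
          rw [this, norm_neg, norm_mul, norm_pow, norm_inv, hζ1]; simp
        rw [e]
        gcongr
        refine (norm_sub_le _ _).trans ?_
        simp [hζ1]; norm_num
      have hsin : ‖ζ ^ h - 1‖ = 2 * Real.sin (π * h / B) := by
        have e : ζ ^ h = Complex.exp (Complex.I * ((2 * (π * h / B) : ℝ) : ℂ)) := by
          rw [hζ, ← Complex.exp_nat_mul]
          congr 1; push_cast; ring
        rw [e, Complex.norm_exp_I_mul_ofReal_sub_one, Real.norm_eq_abs, mul_div_cancel_left₀ _
          (two_ne_zero' ℝ), abs_of_nonneg]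
        have : 0 ≤ Real.sin (π * h / B) := by
          apply Real.sin_nonneg_of_nonneg_of_le_pi
          · positivity
          · rw [div_le_iff₀ hBR]
            have : (h : ℝ) ≤ B := by exact_mod_cast hh.le
            nlinarith [Real.pi_pos]
        positivity
      have hh0 : (0 : ℝ) < h := by exact_mod_cast Nat.pos_of_ne_zero h0
      have hhB : (0 : ℝ) < (B - h : ℕ) := by exact_mod_cast Nat.sub_pos_of_lt hh
      have hBh : ((B - h : ℕ) : ℝ) = B - h := by push_cast [hh.le]; ring
      have hjordan : 2 * h * (B - h : ℕ) / B ^ 2 ≤ Real.sin (π * h / B) := by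
        rcases le_total (2 * (h : ℝ)) B with hle | hle
        · have := Real.mul_le_sin (x := π * h / B) (by positivity) (by
            rw [div_le_iff₀ hBR]; nlinarith [Real.pi_pos])
          refine le_trans ?_ this
          have e : 2 / π * (π * h / B) = 2 * h * B / B ^ 2 := by
            field_simp
          rw [e]
          gcongr
          exact_mod_cast Nat.sub_le B h
        · have := Real.mul_le_sin (x := π - π * h / B) (by
            rw [sub_nonneg, div_le_iff₀ hBR]; nlinarith [Real.pi_pos]) (by
            rw [sub_le_iff_le_add, ← sub_le_iff_le_add', le_div_iff₀ hBR]
            nlinarith [Real.pi_pos])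
          rw [Real.sin_pi_sub] at this
          refine le_trans ?_ this
          have e : 2 / π * (π - π * h / B) = 2 * B * (B - h : ℕ) / B ^ 2 := by
            rw [hBh]; field_simp
          rw [e]
          gcongr
      have hpos : 0 < 2 * h * (B - h : ℕ) / (B : ℝ) ^ 2 := by positivity
      calc 1 / (B : ℝ) * ‖∑ w ∈ Finset.Ico m n, (ζ⁻¹) ^ (h * w)‖
          ≤ 1 / (B : ℝ) * (2 / (2 * (2 * h * (B - h : ℕ) / (B : ℝ) ^ 2))) := by
            rw [hsin] at hgeom
            refine mul_le_mul_of_nonneg_left (hgeom.trans ?_) (by positivity)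
            gcongr
        _ = (1 / h + 1 / (B - h : ℕ)) / 2 := by
            have : (B : ℝ) = h + (B - h : ℕ) := by rw [hBh]; ring
            field_simp
            linarith
    have hid : ∑ v ∈ Finset.Ico m n, g v = ∑ h ∈ Finset.range B,
        ((1 / B : ℂ) * ∑ w ∈ Finset.Ico m n, (ζ⁻¹) ^ (h * w)) *
          ∑ v ∈ Finset.range B, ζ ^ (h * v) * g v := by
      have hsub : ∀ w ∈ Finset.Ico m n, w ∈ Finset.range B := fun w hw => by
        rw [Finset.mem_Ico] at hw; rw [Finset.mem_range]; omega
      have e1 : ∀ w ∈ Finset.Ico m n, g w = (1 / B : ℂ) * ∑ v ∈ Finset.range B,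
          (∑ h ∈ Finset.range B, (ζ⁻¹) ^ (h * w) * ζ ^ (h * v)) * g v := by
        intro w hw
        rw [Finset.sum_congr rfl fun v hv => by rw [horth v hv w (hsub w hw)]]
        simp only [ite_mul, zero_mul]
        rw [Finset.sum_ite_eq' _ _ _, if_pos (hsub w hw)]
        have : (B : ℂ) ≠ 0 := by exact_mod_cast hB.ne'
        field_simp
      rw [Finset.sum_congr rfl e1, ← Finset.mul_sum]
      simp only [mul_assoc, Finset.sum_mul, ← Finset.mul_sum]
      congr 1
      simp only [Finset.mul_sum]
      rw [Finset.sum_comm]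
      rw [Finset.sum_congr rfl fun v _ => Finset.sum_comm, Finset.sum_comm]
      refine Finset.sum_congr rfl fun h _ => ?_
      rw [Finset.sum_comm]
    rw [hid]
    refine (norm_sum_le _ _).trans (Finset.sum_le_sum fun h hh => ?_)
    rw [norm_mul]
    exact mul_le_mul_of_nonneg_right (hcoef h hh) (norm_nonneg _)

/-- The solutions of `u n' = u' n` in `ZMod q` with `1 ≤ u, u' ≤ A` and `n, n'` in the interval
`[n₁, n₁ + L)`, as tuples `((u, u'), (n, n'))`. -/
noncomputable def crossRatioSolutions (q A L : ℕ) (n₁ : ℤ) : Finset ((ℕ × ℕ) × (ℤ × ℤ)) :=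
  ((Finset.Icc 1 A ×ˢ Finset.Icc 1 A) ×ˢ
    (Finset.Ico n₁ (n₁ + L) ×ˢ Finset.Ico n₁ (n₁ + L))).filter
      fun p => (p.1.1 : ZMod q) * p.2.2 = p.1.2 * p.2.1

lemma mem_crossRatioSolutions {q A L : ℕ} {n₁ : ℤ} {p : (ℕ × ℕ) × (ℤ × ℤ)} :
    p ∈ crossRatioSolutions q A L n₁ ↔ (((1 ≤ p.1.1 ∧ p.1.1 ≤ A) ∧ 1 ≤ p.1.2 ∧ p.1.2 ≤ A) ∧
      (n₁ ≤ p.2.1 ∧ p.2.1 < n₁ + L) ∧ n₁ ≤ p.2.2 ∧ p.2.2 < n₁ + L) ∧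
      (p.1.1 : ZMod q) * p.2.2 = p.1.2 * p.2.1 := by
  simp [crossRatioSolutions, Finset.mem_filter, Finset.mem_product]

lemma card_filter_dvd_Ico_le (q L : ℕ) (hq : 0 < q) (hL : L ≤ 2 * q) (n₁ : ℤ) :
    ((Finset.Ico n₁ (n₁ + L)).filter fun n => (q : ℤ) ∣ n).card ≤ 3 := by
  have hqz : (0 : ℤ) < q := by exact_mod_cast hq
  have hcard : (Finset.Icc (n₁ / q) (n₁ / q + 2)).card = 3 := by
    rw [Int.card_Icc]; omega
  rw [← hcard]
  refine Finset.card_le_card_of_injOn (fun n => n / q) ?_ ?_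
  · intro n hn
    simp only [Finset.coe_filter, Set.mem_ofPred_eq, Finset.mem_Ico] at hn
    simp only [Finset.coe_Icc, Set.mem_Icc]
    refine ⟨Int.ediv_le_ediv hqz hn.1.1, ?_⟩
    rw [← Int.add_mul_ediv_right _ _ hqz.ne']
    refine Int.ediv_le_ediv hqz ?_
    have : (L : ℤ) ≤ 2 * q := by exact_mod_cast hL
    linarith [hn.1.2]
  · intro n hn n' hn' h
    simp only [Finset.coe_filter, Set.mem_ofPred_eq] at hn hn'
    simp only at h
    rw [← Int.ediv_mul_cancel hn.2, ← Int.ediv_mul_cancel hn'.2, h]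

lemma card_crossRatioSolutions_diag_le (q A L : ℕ) [Fact q.Prime] (hA : A < q)
    (hL : L ≤ 2 * q) (hAL : A ≤ L) (n₁ : ℤ) :
    ((crossRatioSolutions q A L n₁).filter fun p => p.2.1 = p.2.2).card ≤ 4 * (A * L) := by
  have hsub : ((crossRatioSolutions q A L n₁).filter fun p => p.2.1 = p.2.2) ⊆
      (Finset.Icc 1 A ×ˢ Finset.Ico n₁ (n₁ + L)).image (fun x => ((x.1, x.1), (x.2, x.2))) ∪
      ((Finset.Icc 1 A ×ˢ Finset.Icc 1 A) ×ˢ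
        ((Finset.Ico n₁ (n₁ + L)).filter fun n => (q : ℤ) ∣ n)).image
          (fun x => (x.1, (x.2, x.2))) := by
    rintro ⟨⟨u, u'⟩, ⟨n, n'⟩⟩ hp
    rw [Finset.mem_filter, mem_crossRatioSolutions] at hp
    obtain ⟨⟨⟨⟨⟨h1, h2⟩, h3, h4⟩, ⟨h5, h6⟩, h7, h8⟩, h9⟩, h10⟩ := hp
    simp only at h1 h2 h3 h4 h5 h6 h7 h8 h9 h10
    subst h10
    rw [Finset.mem_union]
    by_cases hn : (q : ℤ) ∣ n
    · right
      refine Finset.mem_image.mpr ⟨((u, u'), n), ?_, rfl⟩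
      simp [Finset.mem_product, *]
    · left
      have hnz : (n : ZMod q) ≠ 0 := by rwa [Ne, ZMod.intCast_zmod_eq_zero_iff_dvd]
      have huu := mul_right_cancel₀ hnz h9
      rw [ZMod.natCast_eq_natCast_iff'] at huu
      rw [Nat.mod_eq_of_lt (by omega), Nat.mod_eq_of_lt (by omega)] at huu
      subst huu
      refine Finset.mem_image.mpr ⟨(u, n), ?_, rfl⟩
      simp [Finset.mem_product, *]
  refine (Finset.card_le_card hsub).trans ((Finset.card_union_le _ _).trans ?_)
  have h1 := Finset.card_image_le (s := Finset.Icc 1 A ×ˢ Finset.Ico n₁ (n₁ + L))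
    (f := fun x : ℕ × ℤ => ((x.1, x.1), (x.2, x.2)))
  have h2 := Finset.card_image_le (s := (Finset.Icc 1 A ×ˢ Finset.Icc 1 A) ×ˢ
        ((Finset.Ico n₁ (n₁ + L)).filter fun n => (q : ℤ) ∣ n))
    (f := fun x : (ℕ × ℕ) × ℤ => (x.1, (x.2, x.2)))
  have h3 := card_filter_dvd_Ico_le q L (Fact.out : q.Prime).pos hL n₁
  simp only [Finset.card_product, Nat.card_Icc, Int.card_Ico, add_sub_cancel_left,
    Int.toNat_natCast, Nat.add_sub_cancel] at h1 h2
  calc _ ≤ A * L + A * A * 3 := Nat.add_le_add h1 (h2.trans (by gcongr))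
    _ ≤ A * L + A * L * 3 := by gcongr
    _ = _ := by ring

lemma card_crossRatioSolutions_offDiag_le (q A L D : ℕ) [Fact q.Prime]
    (hAL : A * L ≤ 4 * q) (n₁ : ℤ)
    (hD : ∀ w : ℕ, w ≠ 0 → w ≤ 4 * q → w.divisors.card ≤ D) :
    ((crossRatioSolutions q A L n₁).filter fun p => ¬ p.2.1 = p.2.2).card ≤
      D * ((2 * A + 1) * L * 9) := by
  have hqz : (0 : ℤ) < q := by exact_mod_cast (Fact.out : q.Prime).pos
  set S := (crossRatioSolutions q A L n₁).filter fun p => ¬ p.2.1 = p.2.2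
  let wt : (ℕ × ℕ) × (ℤ × ℤ) → ℤ := fun p => p.1.2 * (p.2.1 - p.2.2)
  let f : (ℕ × ℕ) × (ℤ × ℤ) → (ℤ × ℤ) × ℤ := fun p =>
    (((p.1.1 : ℤ) - p.1.2, p.2.2), wt p / q)
  have hw : ∀ p ∈ S, wt p ≠ 0 ∧ |wt p| ≤ 4 * q ∧
      wt p % q = (((p.1.1 : ℤ) - p.1.2) * p.2.2) % q := by
    rintro ⟨⟨u, u'⟩, ⟨n, n'⟩⟩ hp
    rw [Finset.mem_filter, mem_crossRatioSolutions] at hp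
    obtain ⟨⟨⟨⟨⟨h1, h2⟩, h3, h4⟩, ⟨h5, h6⟩, h7, h8⟩, h9⟩, h10⟩ := hp
    simp only at h1 h2 h3 h4 h5 h6 h7 h8 h9 h10
    refine ⟨?_, ?_, ?_⟩
    · simp only [wt]
      refine mul_ne_zero (by omega) (by omega)
    · simp only [wt]
      rw [abs_mul, Nat.abs_cast]
      calc (u' : ℤ) * |n - n'| ≤ A * L := by
            gcongr
            rw [abs_le]; constructor <;> linarith
        _ ≤ 4 * q := by exact_mod_cast hAL
    · rw [← ZMod.intCast_eq_intCast_iff']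
      simp only [wt]
      push_cast
      linear_combination -h9
  have hmaps : ∀ p ∈ S, f p ∈ (Finset.Icc (-(A : ℤ)) A ×ˢ Finset.Ico n₁ (n₁ + L)) ×ˢ
      Finset.Icc (-4 : ℤ) 4 := by
    intro p hp
    obtain ⟨-, hb, -⟩ := hw p hp
    rw [Finset.mem_filter, mem_crossRatioSolutions] at hp
    obtain ⟨⟨⟨⟨⟨h1, h2⟩, h3, h4⟩, -, h7, h8⟩, -⟩, -⟩ := hp
    rw [abs_le] at hb
    simp only [f, Finset.mem_product, Finset.mem_Icc, Finset.mem_Ico]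
    refine ⟨⟨⟨by omega, by omega⟩, h7, h8⟩, ?_, ?_⟩
    · rw [Int.le_ediv_iff_mul_le hqz]; linarith
    · calc wt p / q ≤ (4 * q) / q := Int.ediv_le_ediv hqz hb.2
        _ = 4 := Int.mul_ediv_cancel _ hqz.ne'
  have hfib : ∀ t ∈ (Finset.Icc (-(A : ℤ)) A ×ˢ Finset.Ico n₁ (n₁ + L)) ×ˢ
      Finset.Icc (-4 : ℤ) 4, (S.filter fun p => f p = t).card ≤ D := by
    rintro t -
    rcases (S.filter fun p => f p = t).eq_empty_or_nonempty with he | ⟨p₀, hp₀⟩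
    · rw [he]; simp
    rw [Finset.mem_filter] at hp₀
    have hconst : ∀ p ∈ S.filter fun p => f p = t, wt p = wt p₀ := by
      intro p hp
      rw [Finset.mem_filter] at hp
      have h1 := (hw p hp.1).2.2
      have h2 := (hw p₀ hp₀.1).2.2
      have h3 : f p = f p₀ := hp.2.trans hp₀.2.symm
      simp only [f, Prod.mk.injEq] at h3
      rw [h3.1.1, h3.1.2, ← h2] at h1
      rw [← Int.emod_add_mul_ediv (wt p) q, ← Int.emod_add_mul_ediv (wt p₀) q, h1, h3.2]
    obtain ⟨hne, hle, -⟩ := hw p₀ hp₀.1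
    refine le_trans ?_ (hD (wt p₀).natAbs (by simpa using hne)
      (by rw [abs_le] at hle; omega))
    refine Finset.card_le_card_of_injOn (fun p => p.1.2) ?_ ?_
    · intro p hp
      have := hconst p hp
      simp only [Finset.mem_coe, Nat.mem_divisors]
      refine ⟨?_, by simpa using hne⟩
      rw [← this, ← Int.natCast_dvd]
      exact Dvd.intro _ rfl
    · rintro ⟨⟨u, u'⟩, ⟨n, n'⟩⟩ hp ⟨⟨v, v'⟩, ⟨m, m'⟩⟩ hp' h
      have hc := (hconst _ hp).trans (hconst _ hp').symm
      have hf : f _ = f _ := (Finset.mem_filter.mp hp).2.trans (Finset.mem_filter.mp hp').2.symm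
      have hu := (mem_crossRatioSolutions.mp (Finset.mem_filter.mp
        (Finset.mem_filter.mp hp).1).1).1.1.2.1
      simp only [f, wt, Prod.mk.injEq] at hf hc h hu
      obtain ⟨⟨h1, h2⟩, -⟩ := hf
      subst h h2
      have h3 := mul_left_cancel₀ (by omega : (u' : ℤ) ≠ 0) hc
      have h4 : u = v := by omega
      have h5 : n = m := by omega
      rw [h4, h5]
  refine (Finset.card_le_mul_card_image_of_maps_to hmaps D hfib).trans ?_
  gcongr
  simp only [Finset.card_product, Int.card_Icc, Int.card_Ico, add_sub_cancel_left,
    Int.toNat_natCast]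
  gcongr
  · omega
  · norm_num

lemma exists_card_crossRatioSolutions_le (ε : ℝ) (hε : 0 < ε) :
    ∃ C : ℝ, 0 < C ∧ ∀ (q A L : ℕ) [Fact q.Prime], A < q → L ≤ 2 * q → A ≤ L → A * L ≤ 4 * q →
      ∀ n₁ : ℤ, ((crossRatioSolutions q A L n₁).card : ℝ) ≤ C * (q : ℝ) ^ ε * (A * L) := by
  obtain ⟨C, hC, hdiv⟩ := card_divisors_le_rpow ε hε
  refine ⟨4 + (C * 4 ^ ε) * 27, by positivity, fun q A L _ hA hL hAL hALq n₁ => ?_⟩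
  have hq1 : (1 : ℝ) ≤ q := by exact_mod_cast (Fact.out : q.Prime).one_le
  have hqe : 1 ≤ (q : ℝ) ^ ε := Real.one_le_rpow hq1 hε.le
  rcases Nat.eq_zero_or_pos A with rfl | hA0
  · simp [crossRatioSolutions]
  have hA1 : (1 : ℝ) ≤ A := by exact_mod_cast hA0
  set D : ℕ := ⌊C * 4 ^ ε * (q : ℝ) ^ ε⌋₊
  have hD : ∀ w : ℕ, w ≠ 0 → w ≤ 4 * q → w.divisors.card ≤ D := by
    intro w hw hwq
    apply Nat.le_floor
    refine (hdiv w hw).trans ?_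
    rw [mul_assoc, ← Real.mul_rpow (by norm_num) (by positivity)]
    have : (w : ℝ) ≤ 4 * q := by exact_mod_cast hwq
    gcongr
  have hDle : (D : ℝ) ≤ C * 4 ^ ε * (q : ℝ) ^ ε := Nat.floor_le (by positivity)
  rw [← Finset.card_filter_add_card_filter_not (fun p => p.2.1 = p.2.2)]
  push_cast
  calc _ ≤ ((4 * (A * L) : ℕ) : ℝ) + ((D * ((2 * A + 1) * L * 9) : ℕ) : ℝ) := by
        gcongr
        · exact card_crossRatioSolutions_diag_le q A L hA hL hAL n₁
        · exact card_crossRatioSolutions_offDiag_le q A L D hALq n₁ hD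
    _ ≤ (4 * (A * L)) * (q : ℝ) ^ ε + (C * 4 ^ ε * (q : ℝ) ^ ε) * ((2 * A + A) * L * 9) := by
        push_cast
        refine add_le_add (le_mul_of_one_le_right (by positivity) hqe) ?_
        gcongr
    _ = _ := by ring

lemma sum_mul_comp_pow_le {Ω R : Type*} [Fintype R] [DecidableEq R] (S : Finset Ω) (Φ : Ω → R)
    (w : Ω → ℝ) (hw : ∀ x, 0 ≤ w x) (W : R → ℝ) (hW : ∀ r, 0 ≤ W r) (l : ℕ) (hl : 1 ≤ l) :
    (∑ x ∈ S, w x * W (Φ x)) ^ (2 * l) ≤ (∑ x ∈ S, w x) ^ (2 * (l - 1)) *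
      (∑ x ∈ S, ∑ y ∈ S, if Φ x = Φ y then w x * w y else 0) * ∑ r, W r ^ (2 * l) := by
  have hl0 : (l : ℝ) ≠ 0 := by positivity
  have h1 : (∑ x ∈ S, w x * W (Φ x)) ^ l ≤
      (∑ x ∈ S, w x) ^ (l - 1) * ∑ x ∈ S, w x * W (Φ x) ^ l := by
    have := Real.inner_le_weight_mul_Lp_of_nonneg S (p := l) (by exact_mod_cast hl) w
      (fun x => W (Φ x)) hw (fun x => hW _)
    have h0 : 0 ≤ ∑ x ∈ S, w x * W (Φ x) :=
      Finset.sum_nonneg fun x _ => mul_nonneg (hw _) (hW _)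
    have hw0 : 0 ≤ ∑ x ∈ S, w x := Finset.sum_nonneg fun x _ => hw _
    have hw1 : 0 ≤ ∑ x ∈ S, w x * W (Φ x) ^ l :=
      Finset.sum_nonneg fun x _ => mul_nonneg (hw _) (pow_nonneg (hW _) _)
    simp only [Real.rpow_natCast] at this
    refine (pow_le_pow_left₀ h0 this l).trans_eq ?_
    rw [mul_pow, ← Real.rpow_natCast, ← Real.rpow_mul hw0, ← Real.rpow_natCast (_ ^ _),
      ← Real.rpow_mul hw1, inv_mul_cancel₀ hl0, Real.rpow_one]
    congr 1
    rw [← Real.rpow_natCast]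
    congr 1
    rw [Nat.cast_sub hl]
    field_simp
    simp
  set ν : R → ℝ := fun r => ∑ x ∈ S, if Φ x = r then w x else 0 with hν
  have h2 : ∑ x ∈ S, w x * W (Φ x) ^ l = ∑ r, ν r * W r ^ l := by
    simp only [hν, Finset.sum_mul, ite_mul, zero_mul]
    rw [Finset.sum_comm]
    simp
  have h3 : ∑ r, ν r ^ 2 = ∑ x ∈ S, ∑ y ∈ S, if Φ x = Φ y then w x * w y else 0 := by
    simp only [hν, sq, Finset.sum_mul_sum]
    rw [Finset.sum_comm]
    refine Finset.sum_congr rfl fun x _ => ?_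
    rw [Finset.sum_comm]
    refine Finset.sum_congr rfl fun y _ => ?_
    simp only [ite_mul, zero_mul, mul_ite, mul_zero]
    rw [Finset.sum_ite_eq]
    simp
  have h0 : 0 ≤ ∑ x ∈ S, w x * W (Φ x) :=
      Finset.sum_nonneg fun x _ => mul_nonneg (hw _) (hW _)
  calc _ = ((∑ x ∈ S, w x * W (Φ x)) ^ l) ^ 2 := by rw [← pow_mul, mul_comm]
    _ ≤ ((∑ x ∈ S, w x) ^ (l - 1) * ∑ r, ν r * W r ^ l) ^ 2 := by
        rw [h2] at h1
        exact pow_le_pow_left₀ (by positivity) h1 2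
    _ = (∑ x ∈ S, w x) ^ (2 * (l - 1)) * (∑ r, ν r * W r ^ l) ^ 2 := by
        rw [mul_pow, ← pow_mul, mul_comm (l - 1)]
    _ ≤ (∑ x ∈ S, w x) ^ (2 * (l - 1)) * ((∑ r, ν r ^ 2) * ∑ r, (W r ^ l) ^ 2) := by
        gcongr
        · exact Even.pow_nonneg (even_two_mul _) _
        · exact Finset.sum_mul_sq_le_sq_mul_sq _ _ _
    _ = _ := by
        rw [h3, ← mul_assoc]
        simp only [← pow_mul, mul_comm l]

lemma card_filter_natCast_zpow_eq_le {q : ℕ} [Fact q.Prime] (a : ℤ) (ha : a ≠ 0) (M : ℕ)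
    (hM : M < q) (e : ZMod q) :
    ((Finset.Ioc M (2 * M)).filter fun m : ℕ => (m : ZMod q) ^ (-a) = e).card ≤ a.natAbs := by
  classical
  have hpos : 0 < a.natAbs := Int.natAbs_pos.mpr ha
  obtain ⟨e', he'⟩ : ∃ e', ∀ x : ZMod q, x ^ (-a) = e → x ^ a.natAbs = e' := by
    rcases le_total 0 a with h | h
    · refine ⟨e⁻¹, fun x hx => ?_⟩
      rw [← hx, zpow_neg, inv_inv, ← zpow_natCast, Int.natAbs_of_nonneg h]
    · refine ⟨e, fun x hx => ?_⟩
      rw [← hx, ← zpow_natCast, Int.ofNat_natAbs_of_nonpos h]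
  refine le_trans ?_ (((Polynomial.nthRoots a.natAbs e').toFinset_card_le).trans
    (Polynomial.card_nthRoots _ _))
  refine Finset.card_le_card_of_injOn (fun m : ℕ => (m : ZMod q)) ?_ ?_
  · intro m hm
    simp only [Finset.coe_filter, Set.mem_ofPred_eq] at hm
    simp only [Finset.mem_coe, Multiset.mem_toFinset]
    rw [Polynomial.mem_nthRoots hpos]
    exact he' _ hm.2
  · intro m hm m' hm' h
    simp only [Finset.coe_filter, Set.mem_ofPred_eq, Finset.mem_Ioc] at hm hm'
    simp only at h
    rw [ZMod.natCast_eq_natCast_iff] at h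
    rcases le_total m m' with hle | hle
    · have := (Nat.modEq_iff_dvd' hle).mp h
      by_contra hne
      exact absurd (Nat.le_of_dvd (by omega) this) (by omega)
    · have := (Nat.modEq_iff_dvd' hle).mp h.symm
      by_contra hne
      exact absurd (Nat.le_of_dvd (by omega) this) (by omega)

lemma sum_pairs_le {Ω R : Type*} [DecidableEq R] (S : Finset Ω) (Φ : Ω → R) (w : Ω → ℝ) :
    (∑ x ∈ S, ∑ y ∈ S, if Φ x = Φ y then w x * w y else 0) ≤
      ∑ x ∈ S, w x ^ 2 * (S.filter fun y => Φ x = Φ y).card := by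
  have h1 : ∑ x ∈ S, ∑ y ∈ S, (if Φ x = Φ y then w x ^ 2 else 0) =
      ∑ x ∈ S, w x ^ 2 * (S.filter fun y => Φ x = Φ y).card := by
    refine Finset.sum_congr rfl fun x _ => ?_
    rw [← Finset.sum_filter, Finset.sum_const, nsmul_eq_mul, mul_comm]
  have h2 : ∑ x ∈ S, ∑ y ∈ S, (if Φ x = Φ y then w y ^ 2 else 0) =
      ∑ x ∈ S, w x ^ 2 * (S.filter fun y => Φ x = Φ y).card := by
    rw [← h1, Finset.sum_comm]
    simp only [eq_comm]
  have h3 : 2 * (∑ x ∈ S, ∑ y ∈ S, if Φ x = Φ y then w x * w y else 0) ≤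
      ∑ x ∈ S, ∑ y ∈ S, (if Φ x = Φ y then w x ^ 2 else 0) +
        ∑ x ∈ S, ∑ y ∈ S, (if Φ x = Φ y then w y ^ 2 else 0) := by
    simp only [Finset.mul_sum, ← Finset.sum_add_distrib]
    refine Finset.sum_le_sum fun x _ => Finset.sum_le_sum fun y _ => ?_
    split_ifs
    · nlinarith [sq_nonneg (w x - w y)]
    · simp
  linarith

/-- The phase `e(s r^{-b} / q)`, extended by zero to `r = 0`. -/
noncomputable def invPowPhase (q : ℕ) [Fact q.Prime] (b : ℤ) (s r : ZMod q) : ℂ :=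
  if r = 0 then 0 else ZMod.stdAddChar (s * r ^ (-b))

/-- The change of variables `(m, (u, n)) ↦ (n / u, ξ m^{-a} u^{-b})` produced by the shift
`n ↦ n + u v`. -/
noncomputable def shiftParam {q : ℕ} [Fact q.Prime] (a b : ℤ) (ξ : ZMod q) (x : ℕ × ℕ × ℤ) :
    ZMod q × ZMod q :=
  ((x.2.2 : ZMod q) / (x.2.1 : ZMod q),
    ξ * (x.1 : ZMod q) ^ (-a) * (x.2.1 : ZMod q) ^ (-b))

section Shift
variable {q : ℕ} [Fact q.Prime]

lemma natCast_ne_zero_of_lt {u : ℕ} (h1 : 1 ≤ u) (h2 : u < q) : (u : ZMod q) ≠ 0 := by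
  rw [Ne, ZMod.natCast_eq_zero_iff]
  exact fun h => absurd (Nat.le_of_dvd h1 h) (by omega)

lemma sum_pairs_shiftParam_le (a b : ℤ) (ha : a ≠ 0) (ξ : ZMod q) (hξ : ξ ≠ 0) (M A L : ℕ)
    (hM : M < q) (hA : A < q) (n₁ : ℤ) (S : Finset ℕ) (hS : S ⊆ Finset.Ioc M (2 * M))
    (w : ℕ → ℝ) :
    (∑ x ∈ S ×ˢ (Finset.Icc 1 A ×ˢ Finset.Ico n₁ (n₁ + L)),
      ∑ y ∈ S ×ˢ (Finset.Icc 1 A ×ˢ Finset.Ico n₁ (n₁ + L)),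
        if shiftParam a b ξ x = shiftParam a b ξ y then w x.1 * w y.1 else 0) ≤
      (a.natAbs * (crossRatioSolutions q A L n₁).card) * ∑ m ∈ S, w m ^ 2 := by
  classical
  refine (sum_pairs_le _ (shiftParam a b ξ) fun x => w x.1).trans ?_
  rw [Finset.sum_product, Finset.mul_sum]
  refine Finset.sum_le_sum fun m hm => ?_
  simp only
  rw [← Finset.mul_sum, mul_comm]
  refine mul_le_mul_of_nonneg_right ?_ (sq_nonneg _)
  set P := Finset.Icc 1 A ×ˢ Finset.Ico n₁ (n₁ + L)
  rw [← Nat.cast_sum, ← Nat.cast_mul, Nat.cast_le]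
  set Z := (P ×ˢ (S ×ˢ P)).filter fun z => shiftParam a b ξ (m, z.1) = shiftParam a b ξ z.2
  have hZ : ∑ p ∈ P, ((S ×ˢ P).filter fun y => shiftParam a b ξ (m, p) = shiftParam a b ξ y).card
      = Z.card := by
    simp only [Z, Finset.card_filter, Finset.sum_product]
  rw [hZ]
  let f : (ℕ × ℤ) × (ℕ × ℕ × ℤ) → (ℕ × ℕ) × (ℤ × ℤ) := fun z =>
    ((z.1.1, z.2.2.1), (z.1.2, z.2.2.2))
  have hZmem : ∀ z ∈ Z, ((1 ≤ z.1.1 ∧ z.1.1 ≤ A) ∧ n₁ ≤ z.1.2 ∧ z.1.2 < n₁ + L) ∧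
      z.2.1 ∈ S ∧ ((1 ≤ z.2.2.1 ∧ z.2.2.1 ≤ A) ∧ n₁ ≤ z.2.2.2 ∧ z.2.2.2 < n₁ + L) := by
    intro z hz
    simpa [Z, P] using (Finset.mem_filter.mp hz).1
  have hZeq : ∀ z ∈ Z, (z.1.2 : ZMod q) / (z.1.1 : ZMod q) = z.2.2.2 / z.2.2.1 ∧
      ξ * (m : ZMod q) ^ (-a) * (z.1.1 : ZMod q) ^ (-b) =
        ξ * (z.2.1 : ZMod q) ^ (-a) * (z.2.2.1 : ZMod q) ^ (-b) := by
    intro z hz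
    simpa [shiftParam] using (Finset.mem_filter.mp hz).2
  have hmaps : ∀ z ∈ Z, f z ∈ crossRatioSolutions q A L n₁ := by
    intro z hz
    obtain ⟨⟨hu, hn⟩, -, hu', hn'⟩ := hZmem z hz
    refine mem_crossRatioSolutions.mpr ⟨⟨⟨hu, hu'⟩, hn, hn'⟩, ?_⟩
    have h1 := natCast_ne_zero_of_lt (q := q) hu.1 (by omega)
    have h2 := natCast_ne_zero_of_lt (q := q) hu'.1 (by omega)
    have := (hZeq z hz).1
    rw [div_eq_div_iff h1 h2] at this
    simp only [f]
    linear_combination -this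
  refine Finset.card_le_mul_card_image_of_maps_to hmaps _ fun t _ => ?_
  rcases (Z.filter fun z => f z = t).eq_empty_or_nonempty with he | ⟨z₀, hz₀⟩
  · rw [he]; simp
  rw [Finset.mem_filter] at hz₀
  refine le_trans ?_ (card_filter_natCast_zpow_eq_le a ha M hM ((z₀.2.1 : ZMod q) ^ (-a)))
  refine Finset.card_le_card_of_injOn (fun z => z.2.1) ?_ ?_
  · intro z hz
    rw [Finset.mem_coe, Finset.mem_filter] at hz
    obtain ⟨-, hzS, hu', -⟩ := hZmem z hz.1
    have h3 : f z = f z₀ := hz.2.trans hz₀.2.symm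
    simp only [f, Prod.mk.injEq] at h3
    have h4 := (hZeq z hz.1).2
    have h5 := (hZeq z₀ hz₀.1).2
    rw [h3.1.1, h5, h3.1.2] at h4
    have hne : ((z₀.2.2.1 : ZMod q)) ^ (-b) ≠ 0 := by
      rw [← h3.1.2]
      exact zpow_ne_zero _ (natCast_ne_zero_of_lt hu'.1 (by omega))
    rw [Finset.mem_coe, Finset.mem_filter]
    exact ⟨hS hzS, (mul_left_cancel₀ hξ (mul_right_cancel₀ hne h4)).symm⟩
  · rintro ⟨⟨u, n⟩, m₁, u', n'⟩ hz ⟨⟨v, k⟩, m₂, v', k'⟩ hz' h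
    have hf : f _ = f _ := (Finset.mem_filter.mp hz).2.trans (Finset.mem_filter.mp hz').2.symm
    simp only [f, Prod.mk.injEq] at hf h
    simp [hf, h]

lemma sum_norm_invPowPhase_pow_le (b : ℤ) (l : ℕ) (hl : 1 ≤ l) (C : ℝ)
    (hC : ∀ V : Finset (ZMod q), V.card ^ l ≤ q →
      ∀ c : ZMod q → ZMod q → ℂ, (∀ r x, ‖c r x‖ ≤ 1) →
        ∑ r : ZMod q, ∑ s : ZMod q,
          ‖∑ x ∈ V, c r x * ZMod.stdAddChar (s * (r + x) ^ (-b))‖ ^ (2 * l) ≤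
            C * q ^ 2 * V.card ^ l)
    (B : ℕ) (hB : B ^ l ≤ q) (η : ℕ → ℂ) (hη : ∀ v, ‖η v‖ ≤ 1) :
    ∑ y : ZMod q × ZMod q, ‖∑ v ∈ Finset.range B, η v * invPowPhase q b y.2 (y.1 + v)‖ ^ (2 * l) ≤
      C * q ^ 2 * B ^ l := by
  classical
  have hBq : B ≤ q := (Nat.le_self_pow (by omega) B).trans hB
  have hinj : Set.InjOn (fun v : ℕ => (v : ZMod q)) (Finset.range B) := by
    intro v hv w hw h
    simp only [Finset.coe_range, Set.mem_Iio] at hv hw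
    simp only at h
    rwa [ZMod.natCast_eq_natCast_iff', Nat.mod_eq_of_lt (by omega),
      Nat.mod_eq_of_lt (by omega)] at h
  set V := (Finset.range B).image fun v : ℕ => (v : ZMod q)
  have hV : V.card = B := by
    rw [Finset.card_image_of_injOn hinj, Finset.card_range]
  have := hC V (by rwa [hV]) (fun r x => if r + x = 0 then 0 else η x.val) (fun r x => by
    split_ifs
    · simp
    · exact hη _)
  rw [hV] at this
  refine le_trans (le_of_eq ?_) this
  rw [Fintype.sum_prod_type]
  refine Finset.sum_congr rfl fun r _ => Finset.sum_congr rfl fun s _ => ?_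
  congr 2
  rw [Finset.sum_image hinj]
  refine Finset.sum_congr rfl fun v hv => ?_
  rw [Finset.mem_range] at hv
  rw [ZMod.val_natCast, Nat.mod_eq_of_lt (by omega), invPowPhase]
  split_ifs <;> simp

lemma exists_eq_Ico_of_ordConnected (S : Finset ℕ) (B : ℕ) (hS : S ⊆ Finset.range B)
    (h : ∀ x ∈ S, ∀ y ∈ S, ∀ z, x ≤ z → z ≤ y → z ∈ S) :
    ∃ m n, n ≤ B ∧ S = Finset.Ico m n := by
  rcases S.eq_empty_or_nonempty with rfl | hne
  · exact ⟨0, 0, by omega, by simp⟩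
  refine ⟨S.min' hne, S.max' hne + 1, ?_, ?_⟩
  · exact Finset.mem_range.mp (hS (S.max'_mem hne))
  · ext z
    rw [Finset.mem_Ico, Nat.lt_succ_iff]
    exact ⟨fun hz => ⟨S.min'_le z hz, S.le_max' z hz⟩,
      fun hz => h _ (S.min'_mem hne) _ (S.max'_mem hne) z hz.1 hz.2⟩

lemma sum_Ico_eq_sum_shift (g : ℤ → ℂ) (n₀ : ℤ) (N t : ℕ) (ht : t ≤ N) :
    ∑ n ∈ Finset.Ico n₀ (n₀ + N), g n = ∑ n ∈ Finset.Ico (n₀ - N) (n₀ - N + (2 * N : ℕ)),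
      if n₀ ≤ n + t ∧ n + t < n₀ + N then g (n + t) else 0 := by
  rw [← Finset.sum_filter]
  symm
  refine Finset.sum_bij (fun n _ => n + t) ?_ ?_ ?_ ?_
  · intro n hn
    rw [Finset.mem_filter] at hn
    exact Finset.mem_Ico.mpr hn.2
  · intro n _ n' _ h
    simpa using h
  · intro n hn
    rw [Finset.mem_Ico] at hn
    refine ⟨n - t, ?_, by ring⟩
    rw [Finset.mem_filter, Finset.mem_Ico]
    push_cast
    omega
  · intros; rfl

lemma invPowPhase_shift (a b ξ' : ℤ) (m u v : ℕ) (n : ℤ) (hu : (u : ZMod q) ≠ 0) :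
    invPowPhase q b ((ξ' : ZMod q) * (m : ZMod q) ^ (-a)) ((n + (u * v : ℕ) : ℤ) : ZMod q) =
      invPowPhase q b (shiftParam a b (ξ' : ZMod q) (m, u, n)).2
        ((shiftParam a b (ξ' : ZMod q) (m, u, n)).1 + v) := by
  have h1 : ((n + (u * v : ℕ) : ℤ) : ZMod q) = u * ((n : ZMod q) / u + v) := by
    push_cast
    field_simp
  rw [h1]
  simp only [invPowPhase, shiftParam, mul_eq_zero, hu, false_or, mul_zpow, mul_assoc]

/-- The shift `n ↦ n + u v`, averaged over `u ≤ A` and `v < B`. -/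
lemma norm_sum_mul_le_shift (a b ξ : ℤ) (α : ℕ → ℂ) (S : Finset ℕ) (N A B : ℕ)
    (hA : A < q) (hAB : A * B ≤ N) (n₀ : ℤ) (c : ℕ → ℝ) (η : ℕ → ℕ → ℂ)
    (hcomp : ∀ (g : ℕ → ℂ) (m n : ℕ), n ≤ B → ‖∑ v ∈ Finset.Ico m n, g v‖ ≤
        ∑ h ∈ Finset.range B, c h * ‖∑ v ∈ Finset.range B, η h v * g v‖) :
    ‖∑ m ∈ S, α m * ∑ n ∈ Finset.Ico n₀ (n₀ + N),
        invPowPhase q b ((ξ : ZMod q) * (m : ZMod q) ^ (-a)) (n : ZMod q)‖ * (A * B) ≤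
      ∑ h ∈ Finset.range B, c h *
        ∑ x ∈ S ×ˢ (Finset.Icc 1 A ×ˢ Finset.Ico (n₀ - N) (n₀ - N + (2 * N : ℕ))),
          ‖α x.1‖ * ‖∑ v ∈ Finset.range B, η h v *
            invPowPhase q b (shiftParam a b (ξ : ZMod q) x).2
              ((shiftParam a b (ξ : ZMod q) x).1 + v)‖ := by
  classical
  set k : ℕ → ℤ → ℂ := fun m n =>
    invPowPhase q b ((ξ : ZMod q) * (m : ZMod q) ^ (-a)) (n : ZMod q) with hk
  set J := Finset.Ico (n₀ - N) (n₀ - N + (2 * N : ℕ)) with hJ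
  have hshift : ∀ m, (∑ n ∈ Finset.Ico n₀ (n₀ + N), k m n) * (A * B) =
      ∑ u ∈ Finset.Icc 1 A, ∑ n ∈ J, ∑ v ∈ Finset.range B,
        if n₀ ≤ n + (u * v : ℕ) ∧ n + (u * v : ℕ) < n₀ + N then k m (n + (u * v : ℕ)) else 0 := by
    intro m
    have e : ∀ u ∈ Finset.Icc 1 A, ∑ n ∈ J, ∑ v ∈ Finset.range B,
        (if n₀ ≤ n + (u * v : ℕ) ∧ n + (u * v : ℕ) < n₀ + N then k m (n + (u * v : ℕ)) else 0) =
        B * ∑ n ∈ Finset.Ico n₀ (n₀ + N), k m n := by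
      intro u hu
      rw [Finset.mem_Icc] at hu
      rw [Finset.sum_comm, Finset.sum_congr rfl fun v hv => (sum_Ico_eq_sum_shift (k m) n₀ N (u * v)
        (by
          rw [Finset.mem_range] at hv
          exact (Nat.mul_le_mul hu.2 hv.le).trans hAB)).symm]
      simp
    rw [Finset.sum_congr rfl e]
    simp only [Finset.sum_const, Nat.card_Icc, Nat.add_sub_cancel, nsmul_eq_mul]
    ring
  have hinner : ∀ m, ∀ u ∈ Finset.Icc 1 A, ∀ n ∈ J, ‖∑ v ∈ Finset.range B,
        if n₀ ≤ n + (u * v : ℕ) ∧ n + (u * v : ℕ) < n₀ + N then k m (n + (u * v : ℕ)) else 0‖ ≤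
      ∑ h ∈ Finset.range B, c h * ‖∑ v ∈ Finset.range B, η h v *
            invPowPhase q b (shiftParam a b (ξ : ZMod q) (m, u, n)).2
              ((shiftParam a b (ξ : ZMod q) (m, u, n)).1 + v)‖ := by
    intro m u hu n _
    rw [Finset.mem_Icc] at hu
    rw [← Finset.sum_filter]
    obtain ⟨i, j, hj, hij⟩ := exists_eq_Ico_of_ordConnected
      ((Finset.range B).filter fun v => n₀ ≤ n + (u * v : ℕ) ∧ n + (u * v : ℕ) < n₀ + N) B
      (Finset.filter_subset _ _) (by
        intro x hx y hy z hxz hzy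
        rw [Finset.mem_filter, Finset.mem_range] at *
        have h1 : ((u * x : ℕ) : ℤ) ≤ (u * z : ℕ) := by exact_mod_cast Nat.mul_le_mul_left u hxz
        have h2 : ((u * z : ℕ) : ℤ) ≤ (u * y : ℕ) := by exact_mod_cast Nat.mul_le_mul_left u hzy
        refine ⟨by omega, by linarith [hx.2.1], by linarith [hy.2.2]⟩)
    rw [hij]
    refine (hcomp _ i j hj).trans (le_of_eq ?_)
    refine Finset.sum_congr rfl fun h _ => ?_
    congr 2
    refine Finset.sum_congr rfl fun v _ => ?_
    simp only [hk]
    rw [invPowPhase_shift a b ξ m u v n (natCast_ne_zero_of_lt hu.1 (by omega))]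
  have hnorm : ‖∑ m ∈ S, α m * ∑ n ∈ Finset.Ico n₀ (n₀ + N), k m n‖ * (A * B) =
      ‖∑ m ∈ S, α m * ((∑ n ∈ Finset.Ico n₀ (n₀ + N), k m n) * (A * B))‖ := by
    simp only [← mul_assoc, ← Finset.sum_mul]
    simp [mul_assoc]
  rw [hnorm]
  refine (norm_sum_le _ _).trans ?_
  simp only [Finset.mul_sum]
  rw [Finset.sum_comm, Finset.sum_product]
  refine Finset.sum_le_sum fun m _ => ?_
  rw [norm_mul, hshift, Finset.sum_product]
  refine (mul_le_mul_of_nonneg_left (norm_sum_le _ _) (norm_nonneg _)).trans ?_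
  rw [Finset.mul_sum]
  refine Finset.sum_le_sum fun u hu => ?_
  refine (mul_le_mul_of_nonneg_left (norm_sum_le _ _) (norm_nonneg _)).trans ?_
  rw [Finset.mul_sum]
  refine Finset.sum_le_sum fun n hn => ?_
  refine (mul_le_mul_of_nonneg_left (hinner m u hu n hn) (norm_nonneg _)).trans (le_of_eq ?_)
  rw [Finset.mul_sum]
  exact Finset.sum_congr rfl fun h _ => by ring

end Shift

/-- Combination of Hölder's inequality with the two moment bounds. -/
lemma pow_le_of_shift_bound {j : ℕ} {s A B N M E κ Λ Q t : ℝ} (hA : 0 < A)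
    (hB : 0 < B) (hN : 0 < N) (hM : 0 < M) (hE : 0 ≤ E) (hκ : 0 ≤ κ) (hΛ : 0 ≤ Λ) (hQ : 0 < Q)
    (h : (s * (A * B)) ^ (2 * (j + 1)) ≤ Λ ^ (2 * (j + 1)) *
      (((A * (2 * N)) ^ 2 * (M * E)) ^ j * (κ * (A * (2 * N)) * E) * (Q ^ 2 * B ^ (j + 1))))
    (hNQ : N * Q ≤ 2 ^ (j + 1) * A * B ^ (j + 1) * t) :
    s ^ (2 * (j + 1)) ≤
      Λ ^ (2 * (j + 1)) * (κ * 8 ^ (j + 1)) * (E ^ (j + 1) * M ^ j * N ^ (2 * j) * (Q * t)) := by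
  have hAB : 0 < (A * B) ^ (2 * (j + 1)) := by positivity
  rw [mul_pow] at h
  refine le_of_mul_le_mul_right (h.trans ?_) hAB
  calc _ = (Λ ^ (2 * (j + 1)) * κ * 2 ^ (2 * j + 1) * A ^ (2 * j + 1) * N ^ (2 * j) * M ^ j *
        E ^ (j + 1) * Q * B ^ (j + 1)) * (N * Q) := by
        have h4 : ((A * (2 * N)) ^ 2 * (M * E)) ^ j =
            2 ^ (2 * j) * (A ^ (2 * j) * N ^ (2 * j) * (M ^ j * E ^ j)) := by
          simp only [mul_pow, ← pow_mul]; ring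
        rw [h4]; ring
    _ ≤ (Λ ^ (2 * (j + 1)) * κ * 2 ^ (2 * j + 1) * A ^ (2 * j + 1) * N ^ (2 * j) * M ^ j *
        E ^ (j + 1) * Q * B ^ (j + 1)) * (2 ^ (j + 1) * A * B ^ (j + 1) * t) := by gcongr
    _ = (2 ^ (3 * j + 2)) * (Λ ^ (2 * (j + 1)) * κ * (A * B) ^ (2 * (j + 1)) * N ^ (2 * j) * M ^ j *
        E ^ (j + 1) * (Q * t)) := by ring
    _ ≤ (8 ^ (j + 1)) * (Λ ^ (2 * (j + 1)) * κ * (A * B) ^ (2 * (j + 1)) * N ^ (2 * j) * M ^ j *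
        E ^ (j + 1) * (Q * t)) := by
        have ht : 0 ≤ t := by
          by_contra! ht
          have : 2 ^ (j + 1) * A * B ^ (j + 1) * t < 0 :=
            mul_neg_of_pos_of_neg (by positivity) ht
          nlinarith [mul_pos hN hQ]
        gcongr
        calc (2 : ℝ) ^ (3 * j + 2) ≤ 2 ^ (3 * (j + 1)) := by
              gcongr
              · norm_num
              · omega
          _ = 8 ^ (j + 1) := by rw [pow_mul]; norm_num
    _ = _ := by ring


lemma eZMod_eq_stdAddChar (q : ℕ) [NeZero q] (x : ZMod q) : eZMod q x = ZMod.stdAddChar x := by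
  rw [ZMod.stdAddChar_apply, ZMod.toCircle_apply, eZMod]

lemma intCast_ne_zero_iff_gcd_eq_one (q : ℕ) [Fact q.Prime] (n : ℤ) :
    (n : ZMod q) ≠ 0 ↔ Int.gcd n q = 1 := by
  rw [Ne, ZMod.intCast_zmod_eq_zero_iff_dvd, Int.gcd_comm, ← Int.isCoprime_iff_gcd_eq_one,
    (Nat.prime_iff_prime_int.mp (Fact.out : q.Prime)).coprime_iff_not_dvd]

lemma sum_norm_mul_pow_le {q : ℕ} [Fact q.Prime] (a b ξ : ℤ) (ha : a ≠ 0)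
    (hξ : (ξ : ZMod q) ≠ 0) {j M A L B : ℕ} (hM : M < q) (hA : A < q) (n₁ : ℤ) (S : Finset ℕ)
    (hS : S ⊆ Finset.Ioc M (2 * M)) (α : ℕ → ℂ) {E X Y : ℝ}
    (hE : ∑ m ∈ Finset.Ioc M (2 * M), ‖α m‖ ^ 2 = E)
    (hX : a.natAbs * (crossRatioSolutions q A L n₁).card ≤ X)
    (η : ℕ → ℂ)
    (hY : ∑ y : ZMod q × ZMod q,
      ‖∑ v ∈ Finset.range B, η v * invPowPhase q b y.2 (y.1 + v)‖ ^ (2 * (j + 1)) ≤ Y) :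
    (∑ x ∈ S ×ˢ (Finset.Icc 1 A ×ˢ Finset.Ico n₁ (n₁ + L)),
      ‖α x.1‖ * ‖∑ v ∈ Finset.range B, η v *
        invPowPhase q b (shiftParam a b (ξ : ZMod q) x).2
          ((shiftParam a b (ξ : ZMod q) x).1 + v)‖) ^ (2 * (j + 1)) ≤
      ((A * L) ^ 2 * (M * E)) ^ j * (X * E) * Y := by
  classical
  have hSE : ∑ m ∈ S, ‖α m‖ ^ 2 ≤ E :=
    hE ▸ Finset.sum_le_sum_of_subset_of_nonneg hS fun _ _ _ => sq_nonneg _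
  have hE0 : 0 ≤ E := hE ▸ Finset.sum_nonneg fun _ _ => sq_nonneg _
  have hX0 : 0 ≤ X := le_trans (by positivity) hX
  have hcard : (S.card : ℝ) ≤ M := by
    have := Finset.card_le_card hS
    rw [Nat.card_Ioc] at this
    exact_mod_cast this.trans (by omega)
  have hsum : ∑ x ∈ S ×ˢ (Finset.Icc 1 A ×ˢ Finset.Ico n₁ (n₁ + L)), ‖α x.1‖ =
      A * L * ∑ m ∈ S, ‖α m‖ := by
    rw [Finset.sum_product, Finset.mul_sum]
    simp
  have hsq : (∑ x ∈ S ×ˢ (Finset.Icc 1 A ×ˢ Finset.Ico n₁ (n₁ + L)), ‖α x.1‖) ^ 2 ≤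
      (A * L) ^ 2 * (M * E) := by
    rw [hsum, mul_pow]
    gcongr
    exact sq_sum_le_card_mul_sum_sq.trans (by gcongr)
  have key := sum_mul_comp_pow_le (S ×ˢ (Finset.Icc 1 A ×ˢ Finset.Ico n₁ (n₁ + L)))
    (shiftParam a b (ξ : ZMod q)) (fun x => ‖α x.1‖) (fun _ => norm_nonneg _)
    (fun y => ‖∑ v ∈ Finset.range B, η v * invPowPhase q b y.2 (y.1 + v)‖)
    (fun _ => norm_nonneg _) (j + 1) (by omega)
  have hpairs := (sum_pairs_shiftParam_le a b ha ξ hξ M A L hM hA n₁ S hS fun m => ‖α m‖).trans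
    (mul_le_mul hX hSE (Finset.sum_nonneg fun _ _ => sq_nonneg _) hX0)
  refine key.trans (mul_le_mul (mul_le_mul ?_ hpairs ?_ (by positivity)) hY
    (Finset.sum_nonneg fun _ _ => by positivity) (by positivity))
  · rw [Nat.add_sub_cancel, pow_mul]
    gcongr
  · exact Finset.sum_nonneg fun _ _ => Finset.sum_nonneg fun _ _ => by split_ifs <;> positivity

lemma two_add_log_le {ε x q : ℝ} (hε : 0 < ε) (hx : 1 ≤ x) (hxq : x ≤ q) :
    2 + Real.log x ≤ (2 + 2 / ε) * q ^ (ε / 2) := by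
  have h1 : Real.log x ≤ q ^ (ε / 2) / (ε / 2) :=
    (Real.log_le_log (by linarith) hxq).trans
      (Real.log_le_rpow_div (by linarith) (by linarith))
  have h2 : 1 ≤ q ^ (ε / 2) := Real.one_le_rpow (by linarith) (by linarith)
  have h3 : q ^ (ε / 2) / (ε / 2) = 2 / ε * q ^ (ε / 2) := by field_simp
  nlinarith

/-- Lengths for the shift `n ↦ n + u v`: `B = ⌊q^{1/l}⌋` and `A = ⌊N / B⌋`. -/
lemma exists_shift_lengths {j q N : ℕ} {t : ℝ} (ht : 1 ≤ t)
    (htq : t ^ (j + 1) = q) (htN : t ≤ N / 10) (hNq : N < q) (hN2 : (N : ℝ) ^ 2 < q * t) :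
    ∃ A B : ℕ, 0 < A ∧ 0 < B ∧ B ^ (j + 1) ≤ q ∧ (B : ℝ) ≤ q ∧ A * B ≤ N ∧ A < q ∧
      A ≤ 2 * N ∧ A * (2 * N) ≤ 4 * q ∧
      (N : ℝ) * q ≤ 2 ^ (j + 1) * A * (B : ℝ) ^ (j + 1) * t := by
  set B := ⌊t⌋₊
  have hB : 0 < B := Nat.floor_pos.mpr ht
  have hB1 : (1 : ℝ) ≤ B := by exact_mod_cast hB
  have hBt : (B : ℝ) ≤ t := Nat.floor_le (by linarith)
  have htB : t ≤ 2 * B := by linarith [Nat.lt_floor_add_one t]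
  have hAB : N / B * B ≤ N := Nat.div_mul_le_self N B
  have hABR : ((N / B : ℕ) : ℝ) * B ≤ N := by exact_mod_cast hAB
  have hN2AB : (N : ℝ) ≤ 2 * ((N / B : ℕ) * B) := by
    have h1 : (N : ℝ) < ((N / B : ℕ) + 1) * B := by
      exact_mod_cast (Nat.div_lt_iff_lt_mul hB).mp (Nat.lt_succ_self (N / B))
    nlinarith
  have hBq : (B : ℝ) ^ (j + 1) ≤ q := htq ▸ pow_le_pow_left₀ (by positivity) hBt _
  have hBq' : B ^ (j + 1) ≤ q := by exact_mod_cast hBq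
  have hN0 : (0 : ℝ) < N := by linarith
  have hA : 0 < N / B := by
    rcases Nat.eq_zero_or_pos (N / B) with h | h
    · rw [h] at hN2AB; simp at hN2AB; subst hN2AB; simp at hN0
    · exact h
  have hAN : N / B ≤ N := Nat.div_le_self N B
  refine ⟨N / B, B, hA, hB, hBq', ?_, hAB, by omega, by omega, ?_, ?_⟩
  · exact_mod_cast (Nat.le_self_pow (by omega) B).trans hBq'
  · have h1 : ((N / B : ℕ) : ℝ) * (2 * N) * t ≤ 4 * q * t := by
      have : ((N / B : ℕ) : ℝ) * t ≤ 2 * N := by nlinarith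
      nlinarith
    exact_mod_cast le_of_mul_le_mul_right h1 (by linarith)
  · have h1 : t ^ j ≤ (2 * B : ℝ) ^ j := pow_le_pow_left₀ (by linarith) htB _
    calc (N : ℝ) * q = N * t ^ j * t := by rw [← htq]; ring
      _ ≤ 2 * ((N / B : ℕ) * B) * (2 * B : ℝ) ^ j * t := by gcongr
      _ = _ := by rw [mul_pow]; ring

lemma le_of_pow_bound {j : ℕ} {s G K q ε E M N R : ℝ} (hG : 0 ≤ G) (hK : 0 ≤ K) (hq : 1 ≤ q)
    (hε : 0 < ε) (hE : 0 ≤ E) (hM : 0 < M) (hN : 0 < N) (hR : 0 ≤ R)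
    (h : s ^ (2 * (j + 1)) ≤ (G * q ^ (ε / 2)) ^ (2 * (j + 1)) * ((K * q ^ ε) * 8 ^ (j + 1)) *
      (E ^ (j + 1) * M ^ j * N ^ (2 * j) * R)) :
    s ≤ (G * 8 * (1 + K)) * q ^ ε * E ^ ((1 : ℝ) / 2) * M ^ ((1 : ℝ) / 2) * N *
      (R / (M * N ^ 2)) ^ ((1 : ℝ) / (2 * (j + 1 : ℕ))) := by
  have hroot : ∀ x : ℝ, 0 ≤ x → (x ^ ((1 : ℝ) / 2)) ^ (2 * (j + 1)) = x ^ (j + 1) := by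
    intro x hx
    rw [pow_mul, ← Real.sqrt_eq_rpow, Real.sq_sqrt hx]
  have hroot' : ((R / (M * N ^ 2)) ^ ((1 : ℝ) / (2 * (j + 1 : ℕ)))) ^ (2 * (j + 1)) =
      R / (M * N ^ 2) := by
    rw [one_div, ← Nat.cast_ofNat (R := ℝ), ← Nat.cast_mul]
    exact Real.rpow_inv_natCast_pow (by positivity) (by positivity)
  have hP : 1 ≤ q ^ ε := Real.one_le_rpow hq hε.le
  have hp : (q ^ (ε / 2)) ^ (2 * (j + 1)) = (q ^ ε) ^ (j + 1) := by
    rw [pow_mul, ← Real.rpow_natCast (q ^ (ε / 2)) 2, ← Real.rpow_mul (by linarith)]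
    norm_num
  refine le_of_pow_le_pow_left₀ (n := 2 * (j + 1)) (by omega) (by positivity) (h.trans ?_)
  simp only [mul_pow _ _ (2 * (j + 1))]
  rw [hroot E hE, hroot M hM.le, hroot', hp]
  set P := q ^ ε
  have hR' : M ^ (j + 1) * N ^ (2 * (j + 1)) * (R / (M * N ^ 2)) = M ^ j * N ^ (2 * j) * R := by
    field_simp
    ring
  have h1 : P ^ (j + 2) ≤ P ^ (2 * (j + 1)) := pow_le_pow_right₀ hP (by omega)
  have h2 : (8 : ℝ) ^ (j + 1) ≤ 8 ^ (2 * (j + 1)) := pow_le_pow_right₀ (by norm_num) (by omega)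
  have h3 : K ≤ (1 + K) ^ (2 * (j + 1)) :=
    (by linarith : K ≤ 1 + K).trans (le_self_pow₀ (by linarith) (by omega))
  calc _ = G ^ (2 * (j + 1)) * 8 ^ (j + 1) * K * P ^ (j + 2) * E ^ (j + 1) *
        (M ^ j * N ^ (2 * j) * R) := by ring
    _ ≤ G ^ (2 * (j + 1)) * 8 ^ (2 * (j + 1)) * (1 + K) ^ (2 * (j + 1)) * P ^ (2 * (j + 1)) *
        E ^ (j + 1) * (M ^ j * N ^ (2 * j) * R) := by gcongr
    _ = _ := by rw [← hR']; ring

/-- **type I bilinear bound.** Let `a ≠ 0`, `b ≤ −3` or `b ≥ 1`, `l ≥ 2`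
(with `l ≤ −b` if `b ≤ −3`). For every `ε > 0` there is `C > 0` such that for every prime `q`,
all `M, N` with `q^{1/l} ≤ N/10`, `M, N < q`, `N² < q^{1+1/l}`, every `ξ` coprime to `q`,
every sequence `(α_m)` and every set of `N` consecutive integers starting at `n₀`:
`|Σ_m α_m Σ_n e_q(ξ m^{-a} n^{-b})| ≤ C q^ε ‖α‖₂ M^{1/2} N (q^{1+1/l}/(M N²))^{1/(2l)}`. -/
theorem typeI_bilinear_bound_additive_char
    (a b : ℤ) (ha : a ≠ 0) (hb : b ≤ -3 ∨ 1 ≤ b)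
    (l : ℕ) (hl : 2 ≤ l) (hlb : b ≤ -3 → (l : ℤ) ≤ -b) :
    ∀ ε : ℝ, 0 < ε → ∃ C : ℝ, 0 < C ∧
      ∀ (q : ℕ) [Fact (Nat.Prime q)], ∀ M N : ℕ, 0 < M → 0 < N →
        (q : ℝ) ^ ((1 : ℝ) / l) ≤ (N : ℝ) / 10 → M < q → N < q →
        (N : ℝ) ^ 2 < (q : ℝ) ^ (1 + (1 : ℝ) / l) →
        ∀ ξ : ℤ, Int.gcd ξ q = 1 → ∀ α : ℕ → ℂ, ∀ n₀ : ℤ,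
          ‖∑ m ∈ Finset.Ioc M (2 * M),
              if Nat.gcd m q = 1 then
                α m * ∑ n ∈ Finset.Ico n₀ (n₀ + N),
                  if Int.gcd n q = 1 then
                    eZMod q ((ξ : ZMod q) * ((m : ZMod q)) ^ (-a) * ((n : ZMod q)) ^ (-b))
                  else 0
              else 0‖ ≤
            C * (q : ℝ) ^ ε *
              (∑ m ∈ Finset.Ioc M (2 * M), ‖α m‖ ^ 2) ^ ((1 : ℝ) / 2) *
              (M : ℝ) ^ ((1 : ℝ) / 2) * (N : ℝ) *
              ((q : ℝ) ^ (1 + (1 : ℝ) / l) / ((M : ℝ) * (N : ℝ) ^ 2)) ^ ((1 : ℝ) / (2 * l)) := by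
  intro ε hε
  obtain ⟨C₁, hC₁, hcross⟩ := exists_card_crossRatioSolutions_le ε hε
  obtain ⟨C₂, hC₂, hmean⟩ := exists_sum_norm_pow_le b l hb hlb
  obtain ⟨j, rfl⟩ : ∃ j, l = j + 1 := ⟨l - 1, by omega⟩
  set G : ℝ := 2 + 2 / ε with hG
  set K : ℝ := a.natAbs * C₁ * C₂ with hK
  have hG0 : 0 < G := by positivity
  have hK0 : 0 ≤ K := by positivity
  refine ⟨G * 8 * (1 + K), by positivity, ?_⟩
  intro q _ M N hM hN htN hMq hNq hN2 ξ hξ α n₀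
  have hq1 : 1 ≤ q := (Fact.out : q.Prime).one_lt.le
  have hq1R : (1 : ℝ) ≤ q := by exact_mod_cast hq1
  have hqt : (q : ℝ) ^ (1 + (1 : ℝ) / (j + 1 : ℕ)) = q * (q : ℝ) ^ ((1 : ℝ) / (j + 1 : ℕ)) := by
    rw [Real.rpow_add (by linarith), Real.rpow_one]
  rw [hqt] at hN2 ⊢
  set t : ℝ := (q : ℝ) ^ ((1 : ℝ) / (j + 1 : ℕ)) with ht
  have ht1 : 1 ≤ t := Real.one_le_rpow hq1R (by positivity)
  have htq : t ^ (j + 1) = q := by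
    rw [ht, one_div]
    exact Real.rpow_inv_natCast_pow (by linarith) (by omega)
  obtain ⟨A, B, hA, hB, hBq, hBqR, hAB, hAq, hA2N, hAN, hNq'⟩ :=
    exists_shift_lengths ht1 htq htN hNq hN2
  obtain ⟨c, η, hc, hη, hcsum, hcomp⟩ := exists_completion B hB
  set E : ℝ := ∑ m ∈ Finset.Ioc M (2 * M), ‖α m‖ ^ 2 with hE
  have hE0 : 0 ≤ E := Finset.sum_nonneg fun _ _ => sq_nonneg _
  set S := (Finset.Ioc M (2 * M)).filter fun m => Nat.gcd m q = 1
  have hS : S ⊆ Finset.Ioc M (2 * M) := Finset.filter_subset _ _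
  have hsum : (∑ m ∈ Finset.Ioc M (2 * M), if Nat.gcd m q = 1 then
      α m * ∑ n ∈ Finset.Ico n₀ (n₀ + N), (if Int.gcd n q = 1 then
        eZMod q ((ξ : ZMod q) * ((m : ZMod q)) ^ (-a) * ((n : ZMod q)) ^ (-b)) else 0) else 0) =
      ∑ m ∈ S, α m * ∑ n ∈ Finset.Ico n₀ (n₀ + N),
        invPowPhase q b ((ξ : ZMod q) * (m : ZMod q) ^ (-a)) (n : ZMod q) := by
    rw [Finset.sum_filter]
    simp only [← intCast_ne_zero_iff_gcd_eq_one, eZMod_eq_stdAddChar, invPowPhase, ite_not]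
  rw [hsum]
  set s : ℝ := ‖∑ m ∈ S, α m * ∑ n ∈ Finset.Ico n₀ (n₀ + N),
    invPowPhase q b ((ξ : ZMod q) * (m : ZMod q) ^ (-a)) (n : ZMod q)‖
  have hAR : (0 : ℝ) < A := by exact_mod_cast hA
  have hBR : (0 : ℝ) < B := by exact_mod_cast hB
  have hMR : (0 : ℝ) < M := by exact_mod_cast hM
  have hNR : (0 : ℝ) < N := by exact_mod_cast hN
  set X : ℝ := a.natAbs * C₁ * (q : ℝ) ^ ε * (A * (2 * N)) with hX
  set Y : ℝ := ((A * (2 * N)) ^ 2 * (M * E)) ^ j * (X * E) *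
    (C₂ * (q : ℝ) ^ 2 * (B : ℝ) ^ (j + 1)) with hY
  have hY0 : 0 ≤ Y := by positivity
  have hcross' : a.natAbs * (crossRatioSolutions q A (2 * N) (n₀ - N)).card ≤ X := by
    have := hcross q A (2 * N) hAq (by omega) hA2N hAN (n₀ - N)
    rw [hX, mul_assoc, mul_assoc, ← mul_assoc C₁]
    push_cast at this
    gcongr
  set T : ℝ := Y ^ (((2 * (j + 1) : ℕ) : ℝ)⁻¹) with hT
  have hTpow : T ^ (2 * (j + 1)) = Y := Real.rpow_inv_natCast_pow hY0 (by omega)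
  have hT0 : 0 ≤ T := Real.rpow_nonneg hY0 _
  have hbound : s * (A * B) ≤ G * (q : ℝ) ^ (ε / 2) * T := by
    refine (norm_sum_mul_le_shift a b ξ α S N A B hAq hAB n₀ c η hcomp).trans ?_
    calc _ ≤ ∑ h ∈ Finset.range B, c h * T := by
          refine Finset.sum_le_sum fun h _ => mul_le_mul_of_nonneg_left ?_ (hc h)
          refine le_of_pow_le_pow_left₀ (n := 2 * (j + 1)) (by omega) hT0 ?_
          rw [hTpow, hY]
          have := sum_norm_mul_pow_le a b ξ ha ((intCast_ne_zero_iff_gcd_eq_one q ξ).mpr hξ) hMq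
            hAq (n₀ - N) S hS α hE.symm hcross' (η h)
            (sum_norm_invPowPhase_pow_le b (j + 1) (by omega) C₂ (hmean q) B hBq (η h) (hη h))
          push_cast at this ⊢
          exact this
      _ ≤ G * (q : ℝ) ^ (ε / 2) * T := by
          rw [← Finset.sum_mul]
          gcongr
          exact hcsum.trans (two_add_log_le hε (by exact_mod_cast hB) hBqR)
  refine le_of_pow_bound hG0.le hK0 hq1R hε hE0 hMR hNR (by positivity) ?_
  refine pow_le_of_shift_bound hAR hBR hNR hMR hE0 (by positivity) (by positivity)
    (by linarith : (0 : ℝ) < q) ?_ hNq'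
  refine (pow_le_pow_left₀ (by positivity) hbound _).trans (le_of_eq ?_)
  rw [mul_pow _ T, hTpow, hY, hX, hK]
  ring
end

section
/- Let l ≥ 1 and b ≥ l be integers, and let q be a prime with q > b and q > 2l. Let v_1, …, v_{2l} be elements of the field F_q with q elements. If Σ_{i=1}^{l} (r + v_i)^b = Σ_{i=1}^{l} (r + v_{l+i})^b holds in F_q for every r ∈ F_q, then for every index 1 ≤ i ≤ l there exists an index 1 ≤ h ≤ l such that v_i = v_{l+h}. -/
open Polynomial in
/-- Over a domain with more than `b` elements in which `b.choose j ≠ 0` for `j ≤ b`, the values of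
`∑ i, (r + v i) ^ b` determine the power sums of `v` up to exponent `b`. -/
theorem sum_pow_eq_of_forall_sum_add_pow_eq {ι K : Type*} [Fintype ι] [CommRing K] [IsDomain K]
    [Fintype K] {b : ℕ} (hb : b < Fintype.card K) (hchoose : ∀ j ≤ b, (b.choose j : K) ≠ 0)
    {v w : ι → K} (h : ∀ r : K, ∑ i, (r + v i) ^ b = ∑ i, (r + w i) ^ b) {j : ℕ} (hj : j ≤ b) :
    ∑ i, v i ^ j = ∑ i, w i ^ j := by
  let P : (ι → K) → K[X] := fun u => ∑ i, (X + C (u i)) ^ b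
  have hdeg (u : ι → K) : (P u).natDegree ≤ b :=
    natDegree_sum_le_of_forall_le _ _ fun i _ => (natDegree_pow_X_add_C b (u i)).le
  have hzero : P v - P w = 0 := by
    refine eq_zero_of_natDegree_lt_card_of_eval_eq_zero (P v - P w) Function.injective_id
      (fun r => ?_) (((natDegree_sub_le _ _).trans (max_le (hdeg v) (hdeg w))).trans_lt hb)
    simp [P, eval_finsetSum, h r]
  have hcoeff := congrArg (fun p => coeff p (b - j)) (sub_eq_zero.mp hzero)
  simp only [P, finsetSum_coeff, coeff_X_add_C_pow, Nat.sub_sub_self hj,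
    ← Finset.sum_mul] at hcoeff
  exact mul_right_cancel₀ (hchoose _ (Nat.sub_le _ _)) hcoeff

/-- Power sums up to exponent `l` determine the elementary symmetric functions up to degree `l`,
provided the positive integers up to `l` are nonzero. -/
theorem esymm_eq_of_sum_pow_eq {ι K : Type*} [Fintype ι] [CommRing K] [IsDomain K] {l : ℕ}
    (hl : ∀ k, 1 ≤ k → k ≤ l → (k : K) ≠ 0) {v w : ι → K}
    (h : ∀ j ≤ l, ∑ i, v i ^ j = ∑ i, w i ^ j) (k : ℕ) (hk : k ≤ l) :
    (Finset.univ.val.map v).esymm k = (Finset.univ.val.map w).esymm k := by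
  induction k using Nat.strong_induction_on with
  | _ k ih =>
    rcases Nat.eq_zero_or_pos k with rfl | hpos
    · simp [Multiset.esymm]
    refine mul_left_cancel₀ (hl k hpos hk) ?_
    have newton (u : ι → K) :=
      congrArg (MvPolynomial.aeval u) (MvPolynomial.mul_esymm_eq_sum ι K k)
    simp only [map_mul, map_sum, map_pow, map_neg, map_one, map_natCast, MvPolynomial.psum,
      MvPolynomial.aeval_X, MvPolynomial.aeval_esymm_eq_multiset_esymm] at newton
    rw [newton v, newton w]
    congr 1
    refine Finset.sum_congr rfl fun a ha => ?_
    obtain ⟨hak, hlt⟩ := Finset.mem_filter.mp ha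
    have := Finset.HasAntidiagonal.mem_antidiagonal.mp hak
    rw [ih a.1 hlt (by omega), h a.2 (by omega)]


/-- Let `1 ≤ l ≤ b` be integers and `q` a prime with `q > b` and `q > 2l`.
If `v_1, …, v_l, w_1, …, w_l ∈ F_q` satisfy `Σ_i (r + v_i)^b = Σ_i (r + w_i)^b` for every
`r ∈ F_q`, then every `v_i` equals some `w_h`. -/
theorem vanishing_power_polynomial_implies_matching
    (l b q : ℕ) (hl : 1 ≤ l) (hlb : l ≤ b) (hq : Nat.Prime q) (hqb : b < q) (hql : 2 * l < q)
    (v w : Fin l → ZMod q)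
    (h : ∀ r : ZMod q, ∑ i, (r + v i) ^ b = ∑ i, (r + w i) ^ b) :
    ∀ i : Fin l, ∃ h : Fin l, v i = w h := by
  have := Fact.mk hq
  have hchoose (j : ℕ) (hj : j ≤ b) : (b.choose j : ZMod q) ≠ 0 := by
    rw [Ne, ZMod.natCast_eq_zero_iff]
    intro hdvd
    refine absurd ((hq.dvd_factorial).mp ?_) hqb.not_ge
    rw [← Nat.choose_mul_factorial_mul_factorial hj, mul_assoc]
    exact hdvd.mul_right _
  have hcast (k : ℕ) (hk : 1 ≤ k) (hkl : k ≤ l) : (k : ZMod q) ≠ 0 := by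
    rw [Ne, ZMod.natCast_eq_zero_iff]
    exact Nat.not_dvd_of_pos_of_lt hk (by omega)
  have hesymm := esymm_eq_of_sum_pow_eq hcast fun j hj =>
    sum_pow_eq_of_forall_sum_add_pow_eq (by rwa [ZMod.card]) hchoose h (hj.trans hlb)
  have hprod : ((Finset.univ.val.map v).map fun t => Polynomial.X - Polynomial.C t).prod =
      ((Finset.univ.val.map w).map fun t => Polynomial.X - Polynomial.C t).prod := by
    simp only [Multiset.prod_X_sub_X_eq_sum_esymm, Multiset.card_map, Finset.card_val,
      Finset.card_univ, Fintype.card_fin]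
    refine Finset.sum_congr rfl fun j hj => ?_
    rw [hesymm j (Nat.lt_succ_iff.mp (Finset.mem_range.mp hj))]
  have hmap := congrArg Polynomial.roots hprod
  rw [Polynomial.roots_multiset_prod_X_sub_C, Polynomial.roots_multiset_prod_X_sub_C] at hmap
  intro i
  have hi : v i ∈ Finset.univ.val.map w := hmap ▸ Multiset.mem_map_of_mem v (Finset.mem_univ i)
  obtain ⟨k, -, hk⟩ := Multiset.mem_map.mp hi
  exact ⟨k, hk.symm⟩
end

section
/- Let l ≥ 1 be an integer, b < 0 an integer, and q a prime with q > 2l. Let v_1, …, v_{2l} be elements of the field F_q with q elements. If the identity Σ_{i=1}^{l} 1/(T + v_i)^{|b|} = Σ_{i=1}^{l} 1/(T + v_{l+i})^{|b|} holds in the field of rational functions F_q(T), then for every index 1 ≤ i ≤ l there exists an index 1 ≤ h ≤ l such that v_i = v_{l+h}. -/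
open Polynomial in
/-- The product over all `c ≠ u` of `(X + c) ^ m`. -/
noncomputable def prodShiftPowErase {K : Type*} [Field K] [Fintype K] [DecidableEq K]
    (m : ℕ) (u : K) : K[X] :=
  ∏ c ∈ Finset.univ.erase u, (X + C c) ^ m

open Polynomial in
theorem eval_neg_prodShiftPowErase {K : Type*} [Field K] [Fintype K] [DecidableEq K]
    {m : ℕ} (hm : m ≠ 0) (a u : K) :
    (prodShiftPowErase m u).eval (-a) =
      if u = a then (prodShiftPowErase m a).eval (-a) else 0 := by
  split_ifs with h
  · rw [h]
  · rw [prodShiftPowErase, eval_prod]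
    exact Finset.prod_eq_zero (i := a) (by simpa using Ne.symm h) (by simp [hm])

open Polynomial in
theorem eval_neg_prodShiftPowErase_self_ne_zero {K : Type*} [Field K] [Fintype K]
    [DecidableEq K] (m : ℕ) (a : K) :
    (prodShiftPowErase m a).eval (-a) ≠ 0 := by
  rw [prodShiftPowErase, eval_prod, Finset.prod_ne_zero_iff]
  intro c hc
  rw [eval_pow, eval_add, eval_X, eval_C, neg_add_eq_sub]
  exact pow_ne_zero _ (sub_ne_zero.mpr (Finset.ne_of_mem_erase hc))

theorem RatFunc.X_add_C_ne_zero {K : Type*} [Field K] (u : K) :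
    (RatFunc.X + RatFunc.C u : RatFunc K) ≠ 0 := by
  have := (map_ne_zero_iff _ (RatFunc.algebraMap_injective K)).mpr (Polynomial.X_add_C_ne_zero u)
  simpa using this

theorem prod_mul_inv_eq_algebraMap_prodShiftPowErase {K : Type*} [Field K] [Fintype K]
    [DecidableEq K] (m : ℕ) (u : K) :
    (∏ c : K, (RatFunc.X + RatFunc.C c) ^ m) * ((RatFunc.X + RatFunc.C u) ^ m)⁻¹ =
      algebraMap _ (RatFunc K) (prodShiftPowErase m u) := by
  rw [← Finset.prod_erase_mul _ _ (Finset.mem_univ u),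
    mul_inv_cancel_right₀ (pow_ne_zero _ (RatFunc.X_add_C_ne_zero u))]
  simp [prodShiftPowErase, map_prod]

/-- Let `l ≥ 1`, `b < 0` be integers and `q > 2l` a prime. If
`v_1, …, v_l, w_1, …, w_l ∈ F_q` satisfy `Σ_i 1/(T + v_i)^{|b|} = Σ_i 1/(T + w_i)^{|b|}`
in `F_q(T)`, then every `v_i` equals some `w_h`. -/
theorem rational_function_identity_implies_matching
    (l : ℕ) (hl : 1 ≤ l) (b : ℤ) (hb : b < 0)
    (q : ℕ) [Fact (Nat.Prime q)] (hql : 2 * l < q)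
    (v w : Fin l → ZMod q)
    (h : ∑ i, ((RatFunc.X + RatFunc.C (v i)) ^ b.natAbs)⁻¹ =
          ∑ i, ((RatFunc.X + RatFunc.C (w i)) ^ b.natAbs)⁻¹) :
    ∀ i : Fin l, ∃ h : Fin l, v i = w h := by
  intro i₀
  by_contra! hne
  have hm : b.natAbs ≠ 0 := Int.natAbs_ne_zero.mpr hb.ne
  have hpoly : ∑ i, prodShiftPowErase b.natAbs (v i) =
      ∑ i, prodShiftPowErase b.natAbs (w i) := by
    apply RatFunc.algebraMap_injective (ZMod q)
    rw [map_sum, map_sum]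
    simp_rw [← prod_mul_inv_eq_algebraMap_prodShiftPowErase]
    rw [← Finset.mul_sum, ← Finset.mul_sum, h]
  have heval := congrArg (Polynomial.eval (-(v i₀))) hpoly
  rw [Polynomial.eval_finsetSum, Polynomial.eval_finsetSum,
    Finset.sum_congr rfl fun i _ => eval_neg_prodShiftPowErase hm (v i₀) (v i),
    Finset.sum_eq_zero fun i _ =>
      (eval_neg_prodShiftPowErase hm (v i₀) (w i)).trans (if_neg (hne i).symm),
    ← Finset.sum_filter, Finset.sum_const, nsmul_eq_mul, mul_eq_zero, or_iff_left (eval_neg_prodShiftPowErase_self_ne_zero _ _),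
    ZMod.natCast_eq_zero_iff] at heval
  have hpos : 0 < (Finset.univ.filter fun i => v i = v i₀).card :=
    Finset.card_pos.mpr ⟨i₀, by simp⟩
  have hle : (Finset.univ.filter fun i => v i = v i₀).card ≤ l :=
    (Finset.card_le_univ _).trans_eq (Fintype.card_fin l)
  have := Nat.le_of_dvd hpos heval
  omega
end

section
/- Let F be a finite field and let a, b, k be positive integers with a dividing #F − 1 and b dividing #F − 1. Then the multiset M = ρ[a] ⊔ ρ[b] ⊔ {1}^k of multiplicative characters of F^× (of cardinality a + b + k, where {1}^k means k copies of the trivial character) is not Kummer induced; that is, there do not exist an integer d > 1 dividing a + b + k and a multiplicative character η of F^× of exact order d such that η·M = M as multisets. -/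
open scoped Classical

/-- The multiplicity of a character `χ` in the multiset `ρ[a] ⊔ ρ[b] ⊔ {1}^k`. -/
noncomputable def multKum (F : Type*) [Field F] (a b k : ℕ) (χ : MulChar F ℂ) : ℕ :=
  (if χ ^ a = 1 then 1 else 0) + (if χ ^ b = 1 then 1 else 0) + (if χ = 1 then k else 0)

/-- For a finite field `F` and positive integers `a, b, k` with
`a, b ∣ #F − 1`, the multiset `ρ[a] ⊔ ρ[b] ⊔ {1}^k` (of cardinality `a + b + k`) is not
Kummer induced: there is no `d > 1` dividing `a + b + k` and no character `η` of exact
order `d` with `η·M = M` as multisets. -/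
theorem multiset_rho_a_b_one_not_kummer_induced
    (F : Type*) [Field F] [Fintype F]
    (a b k : ℕ) (ha : 0 < a) (hb : 0 < b) (hk : 0 < k)
    (hadvd : a ∣ Fintype.card F - 1) (hbdvd : b ∣ Fintype.card F - 1) :
    ¬ ∃ d : ℕ, 1 < d ∧ d ∣ (a + b + k) ∧ ∃ η : MulChar F ℂ, orderOf η = d ∧
        ∀ χ : MulChar F ℂ, multKum F a b k (η * χ) = multKum F a b k χ := by
  rintro ⟨d, hd, -, η, hη, h⟩
  have hη1 : η ≠ 1 := by
    rintro rfl
    rw [orderOf_one] at hη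
    omega
  -- The trivial character has multiplicity `k + 2`, any other character at most `2`.
  have h1 := h 1
  simp only [multKum, mul_one, one_pow, if_true, if_neg hη1] at h1
  split_ifs at h1 <;> omega
end
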